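/- arXiv:math/9908022 — 2 statements merged into one kernel-verified Lean document; each statement's English description precedes it below -/
import Mathlib

section
/- Let A be a commutative Noetherian ring and let E be a chain complex of finitely generated projective A-modules with E_i = 0 for all i < 0. Let 𝔭 be a prime ideal of A with residue field κ(𝔭) (the fraction field of A/𝔭, i.e. the residue field of the localization A_𝔭). Then 𝔭 lies in the support of some homology module H_i(E) (equivalently, the localized complex E_𝔭 is not exact) if and only if H_i(E ⊗_A κ(𝔭)) ≠ 0 for some integer i, where E ⊗_A κ(𝔭) is obtained by applying − ⊗_A κ(𝔭) termwise. -/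
open CategoryTheory CategoryTheory.Limits CategoryTheory.MonoidalCategory

open scoped TensorProduct

/-- If `g` has a generalized inverse `h`, the source of `g` is projective, and `f`, `g` are exact,
then `id - h ∘ g` factors through `f`. -/
lemma Function.Exact.exists_comp_eq_id_sub {R M N P : Type*} [CommRing R]
    [AddCommGroup M] [AddCommGroup N] [AddCommGroup P] [Module R M] [Module R N] [Module R P]
    [Module.Projective R N] {f : M →ₗ[R] N} {g : N →ₗ[R] P} {h : P →ₗ[R] N}
    (hg : g ∘ₗ h ∘ₗ g = g) (hfg : Function.Exact f g) :
    ∃ k : N →ₗ[R] M, f ∘ₗ k = LinearMap.id - h ∘ₗ g := by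
  have hmem (x : N) : (LinearMap.id - h ∘ₗ g : N →ₗ[R] N) x ∈ LinearMap.range f := by
    obtain ⟨y, hy⟩ := (hfg ((LinearMap.id - h ∘ₗ g : N →ₗ[R] N) x)).1 (by
      have := LinearMap.congr_fun hg x
      simp only [LinearMap.comp_apply] at this
      simp [this])
    exact ⟨y, hy⟩
  obtain ⟨k, hk⟩ := Module.projective_lifting_property f.rangeRestrict
    ((LinearMap.id - h ∘ₗ g).codRestrict _ hmem) f.surjective_rangeRestrict
  refine ⟨k, LinearMap.ext fun x ↦ ?_⟩
  exact congr_arg Subtype.val (LinearMap.congr_fun hk x)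

/-- Exactness at a projective module, after a map with a generalized inverse, is preserved by
any tensor product. -/
lemma Function.Exact.lTensor_of_generalizedInverse {R M N P : Type*} (K : Type*) [CommRing R]
    [AddCommGroup M] [AddCommGroup N] [AddCommGroup P] [Module R M] [Module R N] [Module R P]
    [AddCommGroup K] [Module R K]
    [Module.Projective R N] {f : M →ₗ[R] N} {g : N →ₗ[R] P} {h : P →ₗ[R] N}
    (hg : g ∘ₗ h ∘ₗ g = g) (hfg : Function.Exact f g) :
    Function.Exact (f.lTensor K) (g.lTensor K) := by
  obtain ⟨k, hk⟩ := hfg.exists_comp_eq_id_sub hg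
  intro x
  constructor
  · intro hx
    refine ⟨k.lTensor K x, ?_⟩
    rw [← LinearMap.comp_apply, ← LinearMap.lTensor_comp, hk, LinearMap.lTensor_sub,
      LinearMap.lTensor_comp]
    simp [hx]
  · rintro ⟨y, rfl⟩
    rw [← LinearMap.comp_apply, ← LinearMap.lTensor_comp, hfg.linearMap_comp_eq_zero]
    simp

/-- Over a local ring, exactness of `f`, `g` at a finite module can be tested on the residue field
if `g` has a generalized inverse. -/
lemma IsLocalRing.exact_of_exact_lTensor_residueField {R M N P : Type*} [CommRing R]
    [IsLocalRing R]
    [AddCommGroup M] [AddCommGroup N] [AddCommGroup P] [Module R M] [Module R N] [Module R P]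
    [Module.Finite R N] {f : M →ₗ[R] N} {g : N →ₗ[R] P} {h : P →ₗ[R] N}
    (hg : g ∘ₗ h ∘ₗ g = g) (hgf : g ∘ₗ f = 0)
    (hfg : Function.Exact (f.lTensor (ResidueField R)) (g.lTensor (ResidueField R))) :
    Function.Exact f g := by
  set e : N →ₗ[R] N := LinearMap.id - h ∘ₗ g with he
  have hge (x : N) : g (e x) = 0 := by
    have := LinearMap.congr_fun hg x
    simp only [LinearMap.comp_apply] at this
    simp [he, this]
  have hef (x : M) : e (f x) = f x := by
    have := LinearMap.congr_fun hgf x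
    simp only [LinearMap.comp_apply] at this
    simp [he, this]
  have hee (x : N) : e (e x) = e x := by
    change e x - h (g (e x)) = e x
    simp [hge]
  have hle : LinearMap.range e ≤ LinearMap.range f := by
    refine Submodule.le_of_le_smul_of_le_jacobson_bot (I := maximalIdeal R)
      (Submodule.FG.of_finite) (maximalIdeal_le_jacobson _) ?_
    rintro _ ⟨x, rfl⟩
    obtain ⟨z, hz⟩ := (hfg ((1 : ResidueField R) ⊗ₜ[R] e x)).1 (by simp [hge])
    obtain ⟨y, rfl⟩ := TensorProduct.mk_surjective R M (ResidueField R)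
      residue_surjective z
    have hker : e x - f y ∈ LinearMap.ker (TensorProduct.mk R (R ⧸ maximalIdeal R) N 1) := by
      rw [LinearMap.mem_ker, map_sub, sub_eq_zero]
      exact hz.symm
    rw [LinearMap.ker_tensorProductMk] at hker
    have hmem : e (e x - f y) ∈ maximalIdeal R • LinearMap.range e := by
      rw [LinearMap.range_eq_map, ← Submodule.map_smul'']
      exact Submodule.mem_map_of_mem hker
    rw [map_sub, hee, hef] at hmem
    rw [← add_sub_cancel (f y) (e x)]
    exact Submodule.add_mem_sup ⟨y, rfl⟩ hmem
  intro x
  constructor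
  · intro hx
    exact hle ⟨x, by simp [he, hx]⟩
  · rintro ⟨y, rfl⟩
    exact LinearMap.congr_fun hgf y

/-- A bounded below complex of finite projective modules over a local ring is exact if and only if
it is exact after tensoring with the residue field. The map `d n` goes from degree `n` to degree
`n - 1`, where degree `n` is given by `X (n + 1)`. -/
lemma IsLocalRing.forall_exact_iff_forall_exact_lTensor_residueField {R : Type*} [CommRing R]
    [IsLocalRing R] (X : ℕ → Type*) [∀ n, AddCommGroup (X n)] [∀ n, Module R (X n)]
    [∀ n, Module.Finite R (X n)] [∀ n, Module.Projective R (X n)]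
    (d : ∀ n, X (n + 1) →ₗ[R] X n) (hd : ∀ n, d n ∘ₗ d (n + 1) = 0) (hzero : d 0 = 0) :
    (∀ n, Function.Exact (d (n + 1)) (d n)) ↔
      ∀ n, Function.Exact ((d (n + 1)).lTensor (ResidueField R))
        ((d n).lTensor (ResidueField R)) := by
  have step (n : ℕ) (hn : ∃ h, d n ∘ₗ h ∘ₗ d n = d n) (hex : Function.Exact (d (n + 1)) (d n)) :
      ∃ h, d (n + 1) ∘ₗ h ∘ₗ d (n + 1) = d (n + 1) := by
    obtain ⟨h, hh⟩ := hn
    obtain ⟨k, hk⟩ := hex.exists_comp_eq_id_sub hh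
    refine ⟨k, ?_⟩
    rw [← LinearMap.comp_assoc, hk, LinearMap.sub_comp, LinearMap.comp_assoc, hd]
    simp
  have base : ∃ h, d 0 ∘ₗ h ∘ₗ d 0 = d 0 := ⟨0, by simp [hzero]⟩
  constructor
  · intro H n
    have key (n : ℕ) : ∃ h, d n ∘ₗ h ∘ₗ d n = d n := by
      induction n with
      | zero => exact base
      | succ n ih => exact step n ih (H n)
    obtain ⟨h, hh⟩ := key n
    exact (H n).lTensor_of_generalizedInverse _ hh
  · intro H n
    have key (n : ℕ) : ∃ h, d n ∘ₗ h ∘ₗ d n = d n := by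
      induction n with
      | zero => exact base
      | succ n ih =>
        obtain ⟨h, hh⟩ := ih
        exact step n ⟨h, hh⟩ (exact_of_exact_lTensor_residueField hh (hd n) (H n))
    obtain ⟨h, hh⟩ := key n
    exact exact_of_exact_lTensor_residueField hh (hd n) (H n)

/-- Naturality of `K ⊗[B] (B ⊗[A] M) ≃ K ⊗[A] M` in `M`. -/
lemma LinearMap.lTensor_cancelBaseChange {A B K M N : Type*} [CommRing A] [CommRing B]
    [Algebra A B] [AddCommGroup K] [Module A K] [Module B K] [IsScalarTower A B K]
    [AddCommGroup M] [AddCommGroup N] [Module A M] [Module A N]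
    (f : M →ₗ[A] N) (x : K ⊗[B] (B ⊗[A] M)) :
    f.lTensor K (TensorProduct.AlgebraTensorModule.cancelBaseChange A B B K M x) =
      TensorProduct.AlgebraTensorModule.cancelBaseChange A B B K N
        ((f.baseChange B).lTensor K x) := by
  induction x with
  | zero => simp
  | add x y hx hy => simp only [map_add, hx, hy]
  | tmul k y =>
    induction y with
    | zero => simp
    | add x y hx hy => simp only [TensorProduct.tmul_add, map_add, hx, hy]
    | tmul b m => simp

/-- Exactness after tensoring with a `B`-module can be computed by first base changing to `B`. -/
lemma LinearMap.exact_lTensor_baseChange_iff {A B K M N P : Type*} [CommRing A] [CommRing B]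
    [Algebra A B] [AddCommGroup K] [Module A K] [Module B K] [IsScalarTower A B K]
    [AddCommGroup M] [AddCommGroup N] [AddCommGroup P] [Module A M] [Module A N] [Module A P]
    (f : M →ₗ[A] N) (g : N →ₗ[A] P) :
    Function.Exact ((f.baseChange B).lTensor K) ((g.baseChange B).lTensor K) ↔
      Function.Exact (f.lTensor K) (g.lTensor K) := by
  symm
  refine Function.Exact.iff_of_ladder_addEquiv
    (f₁₂ := ((f.baseChange B).lTensor K).toAddMonoidHom)
    (f₂₃ := ((g.baseChange B).lTensor K).toAddMonoidHom)
    (g₁₂ := (f.lTensor K).toAddMonoidHom) (g₂₃ := (g.lTensor K).toAddMonoidHom)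
    (TensorProduct.AlgebraTensorModule.cancelBaseChange A B B K M).toAddEquiv
    (TensorProduct.AlgebraTensorModule.cancelBaseChange A B B K N).toAddEquiv
    (TensorProduct.AlgebraTensorModule.cancelBaseChange A B B K P).toAddEquiv ?_ ?_
  · ext x; exact f.lTensor_cancelBaseChange x
  · ext x; exact g.lTensor_cancelBaseChange x

/-- Vanishing of the homology of `E ⊗ K` in terms of exactness of linear maps. -/
lemma ChainComplex.isZero_homology_tensorRight_iff {A : Type} [CommRing A]
    (E : ChainComplex (ModuleCat.{0} A) ℕ) (K : Type) [AddCommGroup K] [Module A K] (i : ℕ) :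
    IsZero ((((tensorRight (ModuleCat.of A K)).mapHomologicalComplex
        (ComplexShape.down ℕ)).obj E).homology i) ↔
      Function.Exact ((E.d (i + 1) i).hom.lTensor K) ((E.d i (i - 1)).hom.lTensor K) := by
  rw [← HomologicalComplex.exactAt_iff_isZero_homology,
    HomologicalComplex.exactAt_iff' _ (i + 1) i (i - 1) (by simp) (by cases i <;> simp),
    ShortComplex.ShortExact.moduleCat_exact_iff_function_exact,
    ← LinearMap.rTensor_exact_iff_lTensor_exact]
  rfl

/-- A prime is outside the support of `H_i(E)` if and only if the localization of `E` is exact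
in degree `i`. -/
lemma ChainComplex.notMem_support_homology_iff {A : Type} [CommRing A]
    (E : ChainComplex (ModuleCat.{0} A) ℕ) (p : PrimeSpectrum A) (B : Type) [CommRing B] [Algebra A B]
    [IsLocalization.AtPrime B p.asIdeal] (i : ℕ) :
    p ∉ Module.support A (E.homology i) ↔
      Function.Exact ((E.d (i + 1) i).hom.baseChange B) ((E.d i (i - 1)).hom.baseChange B) := by
  let L := ModuleCat.of A B
  have : Module.Flat A L := IsLocalization.flat B p.asIdeal.primeCompl
  have : (tensorRight L).PreservesHomology :=
    ((tensorRight L).exact_tfae.out 1 2).1 (Module.Flat.rTensor_shortComplex_exact L)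
  simp only [LinearMap.baseChange_eq_ltensor]
  rw [← isZero_homology_tensorRight_iff E B i]
  have : IsLocalizedModule p.asIdeal.primeCompl (TensorProduct.mk A B (E.homology i) 1) :=
    (isLocalizedModule_iff_isBaseChange p.asIdeal.primeCompl B _).2
      (TensorProduct.isBaseChange _ _ _)
  rw [Module.notMem_support_iff,
    (IsLocalizedModule.iso p.asIdeal.primeCompl
      (TensorProduct.mk A B (E.homology i) 1)).toEquiv.subsingleton_congr,
    (TensorProduct.comm A B (E.homology i)).toEquiv.subsingleton_congr]
  exact (ModuleCat.isZero_iff_subsingleton (M := (tensorRight L).obj (E.homology i))).symm.trans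
    ((E.sc i).mapHomologyIso (tensorRight L)).isZero_iff.symm

/-- For a non-negatively graded complex `E` of finitely generated projective modules
over a Noetherian ring `A` and a prime ideal `p`, the prime `p` lies in the support of
some homology module of `E` if and only if the complex `E ⊗ κ(p)` has nonzero homology
in some degree, where `κ(p)` is the residue field of the localization `A_p`. -/
theorem support_iff_derived_fibre_nonzero
    (A : Type) [CommRing A] [IsNoetherianRing A]
    (E : ChainComplex (ModuleCat A) ℕ)
    (hproj : ∀ i, Module.Finite A (E.X i) ∧ Module.Projective A (E.X i))
    (p : Ideal A) (hp : p.IsPrime) :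
    (∃ i, (⟨p, hp⟩ : PrimeSpectrum A) ∈ Module.support A (E.homology i)) ↔
    (∃ i, ¬ IsZero ((((tensorRight (ModuleCat.of A
        (IsLocalRing.ResidueField (Localization.AtPrime p)))).mapHomologicalComplex
        (ComplexShape.down ℕ)).obj E).homology i)) := by
  have hfin (i : ℕ) : Module.Finite A (E.X i) := (hproj i).1
  have hprj (i : ℕ) : Module.Projective A (E.X i) := (hproj i).2
  let L := Localization.AtPrime p
  rw [← not_iff_not]
  push Not
  simp only [ChainComplex.notMem_support_homology_iff E ⟨p, hp⟩ L,
    ChainComplex.isZero_homology_tensorRight_iff]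
  -- Degree `-1` is filled with a copy of `E.X 0`, receiving the zero differential `E.d 0 0`.
  have key := IsLocalRing.forall_exact_iff_forall_exact_lTensor_residueField (R := L)
    (fun n ↦ L ⊗[A] E.X (n - 1)) (fun n ↦ (E.d n (n - 1)).hom.baseChange L)
    (fun n ↦ by
      rw [← LinearMap.baseChange_comp]
      change ((E.d (n + 1) n ≫ E.d n (n - 1)).hom).baseChange L = 0
      simp)
    (by simp)
  refine Iff.trans key (forall_congr' fun n ↦ ?_)
  exact LinearMap.exact_lTensor_baseChange_iff (E.d (n + 1) n).hom (E.d n (n - 1)).hom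
end

section
/- Let A be a commutative Noetherian ring which is an algebra over ℂ. Let E be a chain complex of finitely generated projective A-modules with E_i = 0 unless 0 ≤ i ≤ s, and suppose E is not exact. Let 𝔭 be a prime ideal of A which is a minimal element of the support of the homology of E, i.e. 𝔭 is minimal among primes lying in ⋃_i Supp(H_i(E)). Then the height of 𝔭 satisfies ht(𝔭) ≤ s. -/
open CategoryTheory CategoryTheory.Limits

section Chase

/-- A finite free module with a square-zero endomorphism `d`, on which the elements `y l` (for
`l < r`) are null-homotopic relative to an idempotent-like endomorphism `e`, a cycle `z` killed by
the composite of the homotopies, and a covector `v` with `v z = 1`. -/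
structure ChaseData (D : Type*) [CommRing D] (r : ℕ) (y : ℕ → D) where
  n : ℕ
  d : Matrix (Fin n) (Fin n) D
  e : Matrix (Fin n) (Fin n) D
  h : ℕ → Matrix (Fin n) (Fin n) D
  zs : ℕ → Fin n → D
  v : Fin n → D
  d_sq : d * d = 0
  e_h : ∀ l < r, e * h l = h l
  homotopy : ∀ l < r, d * h l + h l * d = y l • e
  e_z : e.mulVec (zs 0) = zs 0
  d_z : d.mulVec (zs 0) = 0
  zs_succ : ∀ l < r, zs (l + 1) = (h l).mulVec (zs l)
  zs_last : zs r = 0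
  v_z : v ⬝ᵥ zs 0 = 1

namespace ChaseData

variable {D : Type*} [CommRing D] {r : ℕ} {y : ℕ → D}

/-- The row vector `v d`. -/
def u (S : ChaseData D r y) : Fin S.n → D := Matrix.vecMul S.v S.d

/-- Chase data can be transported along ring homomorphisms. -/
def map (S : ChaseData D r y) {D' : Type*} [CommRing D'] (f : D →+* D') :
    ChaseData D' r (f ∘ y) where
  n := S.n
  d := S.d.map f
  e := S.e.map f
  h l := (S.h l).map f
  zs l := f ∘ S.zs l
  v := f ∘ S.v
  d_sq := by rw [← Matrix.map_mul, S.d_sq]; ext; simp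
  e_h l hl := by rw [← Matrix.map_mul, S.e_h l hl]
  homotopy l hl := by
    rw [← Matrix.map_mul, ← Matrix.map_mul, ← Matrix.map_add f (map_add f), S.homotopy l hl]
    ext; simp
  e_z := by
    have := S.e_z
    funext i
    rw [← RingHom.map_mulVec, this]; rfl
  d_z := by
    have := S.d_z
    funext i
    rw [← RingHom.map_mulVec, this]; simp
  zs_succ l hl := by
    funext i
    rw [← RingHom.map_mulVec, ← S.zs_succ l hl]; rfl
  zs_last := by rw [S.zs_last]; ext; simp
  v_z := by rw [← RingHom.map_dotProduct, S.v_z, map_one]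

theorem map_u (S : ChaseData D r y) {D' : Type*} [CommRing D'] (f : D →+* D') (k : Fin S.n) :
    (S.map f).u k = f (S.u k) := by
  exact (RingHom.map_vecMul f S.d S.v k).symm

/-- The ideal generated by the `y i` with `i < j`. -/
def lowerIdeal (y : ℕ → D) (j : ℕ) : Ideal D := Ideal.span (y '' Set.Iio j)

theorem lowerIdeal_succ (y : ℕ → D) (j : ℕ) :
    lowerIdeal y (j + 1) = lowerIdeal y j ⊔ Ideal.span {y j} := by
  rw [lowerIdeal, lowerIdeal, ← Ideal.span_union, Set.union_singleton, ← Set.image_insert_eq]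
  congr 2
  ext i
  simp

theorem mulVec_mem {n : ℕ} {I : Ideal D} (M : Matrix (Fin n) (Fin n) D) {w : Fin n → D}
    (hw : ∀ i, w i ∈ I) (i : Fin n) : M.mulVec w i ∈ I :=
  I.sum_mem (t := Finset.univ) (f := fun j => M i j * w j) fun j _ => I.mul_mem_left _ (hw j)

theorem d_zs_mem (S : ChaseData D r y) (j : ℕ) (hj : j ≤ r) (i : Fin S.n) :
    S.d.mulVec (S.zs j) i ∈ lowerIdeal y j ∧
      (j < r → S.d.mulVec (S.zs (j + 1)) i - y j * S.zs j i ∈ lowerIdeal y j) := by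
  have key : ∀ j, j < r → S.e.mulVec (S.zs j) = S.zs j := by
    intro j hj
    cases j with
    | zero => exact S.e_z
    | succ j => rw [S.zs_succ j (by omega), Matrix.mulVec_mulVec, S.e_h j (by omega)]
  have step : ∀ j, j < r → S.d.mulVec (S.zs (j + 1)) =
      y j • S.zs j - (S.h j).mulVec (S.d.mulVec (S.zs j)) := by
    intro j hj
    have := congrArg (fun M => M.mulVec (S.zs j)) (S.homotopy j hj)
    simp only [Matrix.add_mulVec, Matrix.smul_mulVec, key j hj] at this
    rw [S.zs_succ j hj, Matrix.mulVec_mulVec, Matrix.mulVec_mulVec, ← this]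
    simp
  have main : ∀ j, j ≤ r → ∀ i, S.d.mulVec (S.zs j) i ∈ lowerIdeal y j := by
    intro j
    induction j with
    | zero => intro _ i; rw [S.d_z]; simp
    | succ j ih =>
      intro hj i
      rw [step j (by omega), lowerIdeal_succ]
      refine Ideal.sub_mem _ ?_ ?_
      · exact Ideal.mem_sup_right (Ideal.mul_mem_right _ _ (Ideal.mem_span_singleton_self _))
      · exact Ideal.mem_sup_left (mulVec_mem _ (ih (by omega)) i)
  refine ⟨main j hj i, fun hj' => ?_⟩
  rw [step j hj']
  simpa using mulVec_mem (S.h j) (main j hj) i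

/-- If `c` kills the colon ideals of the sequence `y`, then `c ^ r` is in the ideal generated by
the entries of `v d`. -/
theorem pow_mem_span_u (S : ChaseData D r y) (c : D)
    (hc : ∀ j < r, ∀ a, y j * a ∈ lowerIdeal y j → c * a ∈ lowerIdeal y j) :
    c ^ r ∈ Ideal.span (Set.range S.u) := by
  have main : ∀ k ≤ r, ∃ w : Fin S.n → D, ∀ i,
      c ^ k * S.zs (r - k) i - S.d.mulVec w i ∈ lowerIdeal y (r - k) := by
    intro k
    induction k with
    | zero => intro _; exact ⟨0, by simp [S.zs_last]⟩
    | succ k ih =>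
      intro hk
      obtain ⟨w, hw⟩ := ih (by omega)
      obtain ⟨j, hj⟩ : ∃ j, r - k = j + 1 := ⟨r - k - 1, by omega⟩
      have hj' : r - (k + 1) = j := by omega
      rw [hj] at hw
      rw [hj']
      simp only [lowerIdeal_succ, Submodule.mem_sup, Ideal.mem_span_singleton'] at hw
      choose p hp b' hb hsum using hw
      choose w' hw' using hb
      refine ⟨c • w', fun i => ?_⟩
      have h1 : c ^ k • S.zs (j + 1) - S.d.mulVec w = p + y j • w' := by
        funext i
        simp [← hw' i, ← hsum i, mul_comm]
      have h2 := congrArg (fun t => S.d.mulVec t i) h1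
      simp only [Matrix.mulVec_sub, Matrix.mulVec_smul, Matrix.mulVec_mulVec, S.d_sq,
        Matrix.zero_mulVec, sub_zero, Matrix.mulVec_add, Pi.add_apply, Pi.smul_apply,
        smul_eq_mul] at h2
      have h3 := (S.d_zs_mem j (by omega) i).2 (by omega)
      have h4 := mulVec_mem S.d hp i
      have h5 := hc j (by omega) (c ^ k * S.zs j i - S.d.mulVec w' i) (by
        have : y j * (c ^ k * S.zs j i - S.d.mulVec w' i) =
            S.d.mulVec p i - c ^ k * (S.d.mulVec (S.zs (j + 1)) i - y j * S.zs j i) := by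
          linear_combination h2
        rw [this]
        exact Ideal.sub_mem _ h4 (Ideal.mul_mem_left _ _ h3))
      rw [Matrix.mulVec_smul]
      convert h5 using 1
      simp only [Pi.smul_apply, smul_eq_mul]
      ring
  obtain ⟨w, hw⟩ := main r le_rfl
  have hw' : c ^ r • S.zs 0 = S.d.mulVec w := by
    funext i
    have := hw i
    simp only [Nat.sub_self, lowerIdeal, Set.Iio_zero_eq_empty] at this
    simpa [sub_eq_zero] using this
  have := congrArg (fun t => S.v ⬝ᵥ t) hw'
  simp only [dotProduct_smul, S.v_z, smul_eq_mul, mul_one, Matrix.dotProduct_mulVec] at this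
  rw [this]
  exact Ideal.sum_mem _ fun i _ => Ideal.mul_mem_right _ _ (Ideal.subset_span ⟨i, rfl⟩)

end ChaseData

end Chase

section RegularVariables

namespace MvPowerSeries

variable {σ k : Type*} [CommRing k]

theorem mem_span_X_pow_iff (s : Finset σ) (K : ℕ) (f : MvPowerSeries σ k) :
    f ∈ Ideal.span ((fun i => (X i : MvPowerSeries σ k) ^ K) '' s) ↔
      ∀ m : σ →₀ ℕ, (∀ i ∈ s, m i < K) → coeff m f = 0 := by
  classical
  constructor
  · intro hf
    induction hf using Submodule.span_induction with
    | mem x hx =>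
      obtain ⟨i, hi, rfl⟩ := hx
      intro m hm
      exact (X_pow_dvd_iff.mp dvd_rfl) m (hm i hi)
    | zero => simp
    | add x y _ _ hx hy => intro m hm; simp [hx m hm, hy m hm]
    | smul a x _ hx =>
      intro m hm
      rw [smul_eq_mul, coeff_mul]
      refine Finset.sum_eq_zero fun q hq => ?_
      rw [hx q.2 fun i hi => lt_of_le_of_lt ?_ (hm i hi), mul_zero]
      rw [← Finset.HasAntidiagonal.mem_antidiagonal.mp hq]
      simp
  · induction s using Finset.induction_on generalizing f with
    | empty =>
      intro hf
      have : f = 0 := by ext m; simpa using hf m (by simp)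
      simp [this]
    | insert i s _ ih =>
      intro hf
      let g : MvPowerSeries σ k := fun m => if m i < K then coeff m f else 0
      have hg : ∀ m, coeff m g = if m i < K then coeff m f else 0 := fun m => rfl
      have h1 : g ∈ Ideal.span ((fun i => (X i : MvPowerSeries σ k) ^ K) '' s) := by
        refine ih g fun m hm => ?_
        rw [hg]
        split_ifs with h
        · exact hf m (by simpa using ⟨h, hm⟩)
        · rfl
      have h2 : (X i : MvPowerSeries σ k) ^ K ∣ f - g := by
        rw [X_pow_dvd_iff]
        intro m hm
        simp [hg, hm]
      rw [← sub_add_cancel f g, Finset.coe_insert, Set.image_insert_eq, Ideal.span_insert]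
      exact add_mem (Ideal.mem_sup_left (Ideal.mem_span_singleton.mpr h2))
        (Ideal.mem_sup_right h1)

theorem mem_span_X_pow_of_X_pow_mul_mem (s : Finset σ) (j : σ) (hj : j ∉ s) (K : ℕ)
    (f : MvPowerSeries σ k)
    (hf : X j ^ K * f ∈ Ideal.span ((fun i => (X i : MvPowerSeries σ k) ^ K) '' s)) :
    f ∈ Ideal.span ((fun i => (X i : MvPowerSeries σ k) ^ K) '' s) := by
  classical
  rw [mem_span_X_pow_iff] at hf ⊢
  intro m hm
  have := hf (Finsupp.single j K + m) fun i hi => by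
    have : i ≠ j := by rintro rfl; exact hj hi
    simpa [Finsupp.single_apply, this.symm] using hm i hi
  rwa [X_pow_eq, coeff_add_monomial_mul, one_mul] at this

/-- Elements of the `t`-th power of the ideal of variables have order at least `t`. -/
theorem coeff_eq_zero_of_mem_span_X_pow {f : MvPowerSeries σ k} {t : ℕ}
    (hf : f ∈ Ideal.span (Set.range (X : σ → MvPowerSeries σ k)) ^ t) (m : σ →₀ ℕ)
    (hm : m.degree < t) : coeff m f = 0 := by
  classical
  induction t generalizing f m with
  | zero => simp at hm
  | succ t ih =>
    rw [pow_succ'] at hf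
    induction hf using Submodule.mul_induction_on' with
    | add x _ y _ hx hy => simp [hx, hy]
    | mem_mul_mem a ha b hb =>
      rw [coeff_mul]
      refine Finset.sum_eq_zero fun q hq => ?_
      have hq' := Finset.HasAntidiagonal.mem_antidiagonal.mp hq
      by_cases h0 : q.1 = 0
      · have : constantCoeff a = 0 := by
          have h1 : Ideal.span (Set.range (X : σ → MvPowerSeries σ k)) ≤
              RingHom.ker (constantCoeff (σ := σ) (R := k)) := by
            rw [Ideal.span_le]
            rintro _ ⟨i, rfl⟩
            simp
          exact h1 ha
        rw [h0, coeff_zero_eq_constantCoeff, this, zero_mul]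
      · rw [ih hb q.2 ?_, mul_zero]
        have : m.degree = q.1.degree + q.2.degree := by rw [← hq', map_add]
        have : q.1.degree ≠ 0 := by rwa [Ne, Finsupp.degree_eq_zero_iff]
        omega

theorem eq_zero_of_forall_mem_span_X_pow {f : MvPowerSeries σ k}
    (hf : ∀ t, f ∈ Ideal.span (Set.range (X : σ → MvPowerSeries σ k)) ^ t) : f = 0 := by
  ext m
  simpa using coeff_eq_zero_of_mem_span_X_pow (hf (m.degree + 1)) m (Nat.lt_succ_self _)

end MvPowerSeries

end RegularVariables

section Frobenius

theorem LinearMap.apply_mem_of_mem_ideal_map {R D : Type*} [CommRing R] [CommRing D] [Algebra R D]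
    {N : ℕ} (α : D →ₗ[R] Fin N → R) {I : Ideal R} {w : D} (hw : w ∈ I.map (algebraMap R D))
    (i : Fin N) : α w i ∈ I := by
  induction hw using Submodule.span_induction with
  | mem x hx =>
    obtain ⟨a, ha, rfl⟩ := hx
    rw [Algebra.algebraMap_eq_smul_one, map_smul]
    exact I.mul_mem_right _ ha
  | zero => simp
  | add x y _ _ hx hy => simpa using I.add_mem hx hy
  | smul b x hx' _ =>
    clear * - hx'
    induction hx' using Submodule.span_induction generalizing b with
    | mem x hx =>
      obtain ⟨a, ha, rfl⟩ := hx
      rw [smul_eq_mul, mul_comm, ← Algebra.smul_def, map_smul]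
      exact I.mul_mem_right _ ha
    | zero => simp
    | add x y _ _ hx hy => rw [smul_add, map_add]; exact I.add_mem (hx b) (hy b)
    | smul c x _ hx => rw [smul_smul]; exact hx _

theorem LinearMap.apply_mem_ideal_map {R D : Type*} [CommRing R] [CommRing D] [Algebra R D]
    {N : ℕ} (β : (Fin N → R) →ₗ[R] D) {I : Ideal R} {w : Fin N → R} (hw : ∀ i, w i ∈ I) :
    β w ∈ I.map (algebraMap R D) := by
  rw [pi_eq_sum_univ' w, map_sum]
  refine Ideal.sum_mem _ fun i _ => ?_
  rw [map_smul, Algebra.smul_def]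
  exact Ideal.mul_mem_right _ _ (Ideal.mem_map_of_mem _ (hw i))

/-- In characteristic `p`, chase data over an algebra which is almost free over a power series
ring, for powers of at most `d` variables and with `v d` topologically nilpotent, force the
algebra to be killed by a power of the almost-freeness constant. -/
theorem ChaseData.pow_mul_eq_zero {k : Type*} [Field k] (p : ℕ) [Fact p.Prime] [CharP k p]
    {d r N M a : ℕ} (hr : r ≤ d) {D : Type*} [CommRing D] [Algebra (MvPowerSeries (Fin d) k) D]
    (α : D →ₗ[MvPowerSeries (Fin d) k] Fin N → MvPowerSeries (Fin d) k)
    (β : (Fin N → MvPowerSeries (Fin d) k) →ₗ[MvPowerSeries (Fin d) k] D)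
    (c : MvPowerSeries (Fin d) k) (hβ : ∀ w, β (α w) = c • w) (i₀ : Fin N) {y : ℕ → D}
    (S : ChaseData D r y)
    (hy : ∀ l (hl : l < r), y l =
      algebraMap (MvPowerSeries (Fin d) k) D (MvPowerSeries.X ⟨l, hl.trans_le hr⟩ ^ M))
    (hu : ∀ j, S.u j ^ a ∈ (Ideal.span (Set.range
      (MvPowerSeries.X : Fin d → MvPowerSeries (Fin d) k))).map (algebraMap _ D)) :
    c ^ r * α 1 i₀ = 0 := by
  rcases subsingleton_or_nontrivial D with hD | hD
  · rw [Subsingleton.elim (1 : D) 0, map_zero]; simp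
  have : CharP D p := charP_of_injective_ringHom
    (((algebraMap (MvPowerSeries (Fin d) k) D).comp MvPowerSeries.C).injective) p
  refine MvPowerSeries.eq_zero_of_forall_mem_span_X_pow fun t => ?_
  obtain ⟨e, he⟩ : ∃ e, a * t ≤ p ^ e :=
    ⟨a * t, (Nat.lt_pow_self (Fact.out : p.Prime).one_lt).le⟩
  have hyl : ∀ l (hl : l < r), (iterateFrobenius D p e ∘ y) l =
      algebraMap (MvPowerSeries (Fin d) k) D
        (MvPowerSeries.X ⟨l, hl.trans_le hr⟩ ^ (M * p ^ e)) := by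
    intro l hl
    rw [Function.comp, hy l hl, iterateFrobenius_def, ← map_pow, pow_mul]
  have hlow : ∀ j (_ : j < r), ChaseData.lowerIdeal (iterateFrobenius D p e ∘ y) j =
      Ideal.map (algebraMap (MvPowerSeries (Fin d) k) D)
      (Ideal.span ((fun i => (MvPowerSeries.X i : MvPowerSeries (Fin d) k) ^ (M * p ^ e)) ''
        (Finset.univ.filter fun i : Fin d => i.1 < j : Finset (Fin d)))) := by
    intro j hj
    rw [ChaseData.lowerIdeal, Ideal.map_span, ← Set.image_comp]
    congr 1
    ext w
    constructor
    · rintro ⟨l, hl, rfl⟩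
      have hl : l < j := hl
      exact ⟨⟨l, by omega⟩, by simpa using hl, (hyl l (by omega)).symm⟩
    · rintro ⟨l, hl, rfl⟩
      have hl : l.1 < j := by simpa using hl
      exact ⟨l.1, hl, hyl l (by omega)⟩
  have hmem := (S.map (iterateFrobenius D p e)).pow_mem_span_u
      (algebraMap (MvPowerSeries (Fin d) k) D c) (by
    intro j hj b hb
    rw [hlow j hj] at hb ⊢
    rw [hyl j hj, ← Algebra.smul_def] at hb
    rw [← Algebra.smul_def, ← hβ]
    refine LinearMap.apply_mem_ideal_map β fun i => ?_
    have := LinearMap.apply_mem_of_mem_ideal_map α hb i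
    rw [map_smul] at this
    exact MvPowerSeries.mem_span_X_pow_of_X_pow_mul_mem _ _ (by simp) _ _ this)
  have hle : Ideal.span (Set.range (S.map (iterateFrobenius D p e)).u) ≤ (Ideal.span (Set.range
      (MvPowerSeries.X : Fin d → MvPowerSeries (Fin d) k)) ^ t).map
        (algebraMap (MvPowerSeries (Fin d) k) D) := by
    rw [Ideal.span_le]
    rintro _ ⟨j, rfl⟩
    have h1 : (S.map (iterateFrobenius D p e)).u j = S.u j ^ p ^ e :=
      S.map_u (iterateFrobenius D p e) j
    rw [h1, ← Nat.sub_add_cancel he, pow_add, Ideal.map_pow]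
    refine Ideal.mul_mem_left _ _ ?_
    rw [pow_mul]
    exact Ideal.pow_mem_pow (hu j) t
  have := LinearMap.apply_mem_of_mem_ideal_map α (hle hmem) i₀
  rwa [← map_pow, Algebra.algebraMap_eq_smul_one, map_smul] at this

end Frobenius

section Presentation

open Polynomial

/-- Evaluation of integral polynomials at a point `v` of a commutative ring. -/
noncomputable def evalCoeff {ι B : Type*} [CommRing B] (v : ι → B) : MvPolynomial ι ℤ →+* B :=
  MvPolynomial.eval₂Hom (Int.castRingHom B) v

/-- Evaluation of polynomials in one variable over `ℤ[ι]` at a point `(v, θ)`. -/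
noncomputable def evalAt {ι B : Type*} [CommRing B] (v : ι → B) (θ : B) :
    (MvPolynomial ι ℤ)[X] →+* B :=
  eval₂RingHom (evalCoeff v) θ

section evalAt

variable {ι B B' : Type*} [CommRing B] [CommRing B'] (v : ι → B) (θ : B)

@[simp]
theorem evalAt_C (c : MvPolynomial ι ℤ) : evalAt v θ (C c) = evalCoeff v c := by
  simp [evalAt]

@[simp]
theorem evalAt_X : evalAt v θ X = θ := by
  simp [evalAt]

@[simp]
theorem evalCoeff_X (i : ι) : evalCoeff v (MvPolynomial.X i) = v i := by
  simp [evalCoeff]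

theorem map_evalCoeff (h : B →+* B') (c : MvPolynomial ι ℤ) :
    h (evalCoeff v c) = evalCoeff (fun i => h (v i)) c := by
  have : h.comp (evalCoeff v) = evalCoeff (fun i => h (v i)) := by
    refine MvPolynomial.ringHom_ext (fun n => ?_) (fun i => ?_)
    · simp
    · simp
  exact DFunLike.congr_fun this c

theorem map_evalAt (h : B →+* B') (q : (MvPolynomial ι ℤ)[X]) :
    h (evalAt v θ q) = evalAt (fun i => h (v i)) (h θ) q := by
  have : h.comp (evalAt v θ) = evalAt (fun i => h (v i)) (h θ) := by
    refine Polynomial.ringHom_ext (fun c => ?_) ?_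
    · rw [RingHom.comp_apply, evalAt_C, evalAt_C, map_evalCoeff]
    · simp
  exact DFunLike.congr_fun this q

theorem dvd_evalAt_sub {a : B} {v v' : ι → B} {θ θ' : B} (hv : ∀ i, a ∣ v i - v' i)
    (hθ : a ∣ θ - θ') (q : (MvPolynomial ι ℤ)[X]) : a ∣ evalAt v θ q - evalAt v' θ' q := by
  rw [← Ideal.mem_span_singleton, ← Ideal.Quotient.eq, map_evalAt, map_evalAt]
  congr 2
  · funext i
    rw [Ideal.Quotient.eq, Ideal.mem_span_singleton]
    exact hv i
  · rw [Ideal.Quotient.eq, Ideal.mem_span_singleton]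
    exact hθ

end evalAt

/-- A presentation of `B`, after inverting `w`, as a simple extension of a ring of polynomials. -/
structure PrimitivePresentation (B : Type) [CommRing B] where
  ι : Type
  finite_ι : Finite ι
  v : ι → B
  θ : B
  f : (MvPolynomial ι ℤ)[X]
  w : MvPolynomial ι ℤ
  gens : Finset B
  num : B → (MvPolynomial ι ℤ)[X]
  adjoin_gens : Algebra.adjoin ℤ (gens : Set B) = ⊤
  evalAt_f : evalAt v θ f = 0
  dvd_of_evalAt_eq_zero : ∀ q, evalAt v θ q = 0 → ∃ N : ℕ, f ∣ C w ^ N * q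
  mul_gen : ∀ b ∈ gens, evalCoeff v w * b = evalAt v θ (num b)

/-- A point of the presentation with values in a domain `S` at which the denominators divide the
numerators defines a homomorphism to `S`. -/
theorem PrimitivePresentation.exists_ringHom {B : Type} [CommRing B]
    (P : PrimitivePresentation B) {S : Type*} [CommRing S] [IsDomain S] (v' : P.ι → S) (θ' : S)
    (hf : evalAt v' θ' P.f = 0) (hw : evalCoeff v' P.w ≠ 0)
    (hnum : ∀ b ∈ P.gens, evalCoeff v' P.w ∣ evalAt v' θ' (P.num b)) :
    ∃ ψ : B →+* S, ∀ i, ψ (P.v i) = v' i := by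
  have hker : ∀ q, evalAt P.v P.θ q = 0 → evalAt v' θ' q = 0 := by
    intro q hq
    obtain ⟨N, h, hN⟩ := P.dvd_of_evalAt_eq_zero q hq
    have := congrArg (evalAt v' θ') hN
    simp only [map_mul, map_pow, evalAt_C, hf, zero_mul] at this
    exact (mul_eq_zero.mp this).resolve_left (pow_ne_zero _ hw)
  let w₁ : B := evalCoeff P.v P.w
  let w₂ : S := evalCoeff v' P.w
  have hC₁ : evalAt P.v P.θ (C P.w) = w₁ := evalAt_C _ _ _
  have hC₂ : evalAt v' θ' (C P.w) = w₂ := evalAt_C _ _ _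
  let T : Subring (B × S) :=
    { carrier := {x | ∃ (N : ℕ) (q : _), w₁ ^ N * x.1 = evalAt P.v P.θ q ∧
        w₂ ^ N * x.2 = evalAt v' θ' q}
      mul_mem' := by
        rintro x y ⟨N, q, h1, h2⟩ ⟨N', q', h1', h2'⟩
        refine ⟨N + N', q * q', ?_, ?_⟩
        · rw [map_mul, ← h1, ← h1', Prod.fst_mul]; ring
        · rw [map_mul, ← h2, ← h2', Prod.snd_mul]; ring
      one_mem' := ⟨0, 1, by simp, by simp⟩
      add_mem' := by
        rintro x y ⟨N, q, h1, h2⟩ ⟨N', q', h1', h2'⟩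
        refine ⟨N + N', C P.w ^ N' * q + C P.w ^ N * q', ?_, ?_⟩
        · rw [map_add, map_mul, map_mul, map_pow, map_pow, ← h1, ← h1', Prod.fst_add, hC₁]; ring
        · rw [map_add, map_mul, map_mul, map_pow, map_pow, ← h2, ← h2', Prod.snd_add, hC₂]; ring
      zero_mem' := ⟨0, 0, by simp, by simp⟩
      neg_mem' := by
        rintro x ⟨N, q, h1, h2⟩
        exact ⟨N, -q, by simp [← h1], by simp [← h2]⟩ }
  let π : T →+* B := (RingHom.fst B S).comp T.subtype
  have hπ : Function.Bijective π := by
    constructor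
    · rw [injective_iff_map_eq_zero]
      rintro ⟨x, N, q, h1, h2⟩ hx
      have hx : x.1 = 0 := hx
      rw [hx, mul_zero] at h1
      rw [hker q h1.symm] at h2
      have h3 : x.2 = 0 := (mul_eq_zero.mp h2).resolve_left (pow_ne_zero _ hw)
      exact Subtype.ext (Prod.ext hx h3)
    · intro b
      have hb : b ∈ Algebra.adjoin ℤ (P.gens : Set B) := by rw [P.adjoin_gens]; trivial
      have hle : Algebra.adjoin ℤ (P.gens : Set B) ≤ subalgebraOfSubring π.range := by
        refine Algebra.adjoin_le fun b hb => ?_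
        obtain ⟨s, hs⟩ := hnum b hb
        exact ⟨⟨(b, s), 1, P.num b, by simpa using P.mul_gen b hb, by simpa using hs.symm⟩, rfl⟩
      exact hle hb
  let e := RingEquiv.ofBijective π hπ
  refine ⟨((RingHom.snd B S).comp T.subtype).comp e.symm.toRingHom, fun i => ?_⟩
  let t : T := ⟨(P.v i, v' i), 0, C (MvPolynomial.X i), by simp, by simp⟩
  have : e.symm (P.v i) = t := by rw [RingEquiv.symm_apply_eq]; rfl
  change (e.symm (P.v i)).1.2 = v' i
  rw [this]

/-- A perturbation of the identity by higher order terms has a zero close to the origin. -/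
theorem IsAdicComplete.exists_add_sq_mul_eval_add_eq_zero {S : Type*} [CommRing S] (I : Ideal S)
    [IsAdicComplete I S] (h : S[X]) {t : S} (ht : t ∈ I) :
    ∃ ζ ∈ I, ζ + ζ ^ 2 * h.eval ζ + t = 0 := by
  let Φ : S → S := fun z => -(t + z ^ 2 * h.eval z)
  have hΦI : ∀ z ∈ I, Φ z ∈ I := fun z hz =>
    I.neg_mem (I.add_mem ht (I.mul_mem_right _ (I.pow_mem_of_mem hz 2 two_pos)))
  have hΦ : ∀ n, ∀ x ∈ I, ∀ y ∈ I, x - y ∈ I ^ n → Φ x - Φ y ∈ I ^ (n + 1) := by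
    intro n x hx y hy hxy
    obtain ⟨b, hb⟩ := sub_dvd_eval_sub x y h
    have : Φ x - Φ y = -((x - y) * (x * (x * b) + (x + y) * h.eval y)) := by
      simp only [Φ]
      linear_combination (-x ^ 2) * hb
    rw [this, pow_succ]
    exact neg_mem (Ideal.mul_mem_mul hxy
      (I.add_mem (I.mul_mem_right _ hx) (I.mul_mem_right _ (I.add_mem hx hy))))
  let z : ℕ → S := fun n => Φ^[n] 0
  have hz : ∀ n, z (n + 1) = Φ (z n) := fun n => Function.iterate_succ_apply' _ _ _
  have hzI : ∀ n, z n ∈ I := by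
    intro n
    induction n with
    | zero => exact I.zero_mem
    | succ n ih => rw [hz]; exact hΦI _ ih
  have hz' : ∀ n, z (n + 1) - z n ∈ I ^ n := by
    intro n
    induction n with
    | zero => simp
    | succ n ih => rw [hz (n + 1), hz n]; exact hΦ n _ (hz n ▸ hzI _) _ (hzI _) (hz n ▸ ih)
  have hcauchy : ∀ {m n}, m ≤ n → z m ≡ z n [SMOD (I ^ m • ⊤ : Submodule S S)] := by
    intro m n hmn
    rw [SModEq.sub_mem, smul_eq_mul, Ideal.mul_top]
    induction n, hmn using Nat.le_induction with
    | base => simp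
    | succ n hmn ih =>
      rw [← sub_sub_sub_cancel_right _ _ (z n)]
      exact sub_mem ih (Ideal.pow_le_pow_right hmn (hz' n))
  obtain ⟨L, hL⟩ := IsPrecomplete.prec' z @hcauchy
  have hL' : ∀ n, z n - L ∈ I ^ n := fun n => by
    simpa [SModEq.sub_mem] using hL n
  have hLI : L ∈ I := by
    have := I.sub_mem (hzI 1) (by simpa using hL' 1)
    simpa using this
  refine ⟨L, hLI, ?_⟩
  have hfix : L - Φ L = 0 := by
    refine IsHausdorff.haus (I := I) inferInstance _ fun n => ?_
    rw [SModEq.zero, smul_eq_mul, Ideal.mul_top]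
    have h1 : z (n + 1) - Φ L ∈ I ^ n := by
      rw [hz]
      exact Ideal.pow_le_pow_right (Nat.le_succ n) (hΦ n _ (hzI n) _ hLI (hL' n))
    have h2 := Ideal.pow_le_pow_right (Nat.le_succ n) (hL' (n + 1))
    simpa using sub_mem h1 h2
  linear_combination hfix

/-- An approximate point of the presentation can be corrected to a point by Newton's method. -/
theorem PrimitivePresentation.exists_ringHom_of_approx {B : Type} [CommRing B]
    (P : PrimitivePresentation B) {S : Type*} [CommRing S] [IsDomain S] (T : S)
    [IsAdicComplete (Ideal.span {T}) S] (v' : P.ι → S) (θ' a η q : S) (l : B → S)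
    (ha : a ≠ 0) (hq : IsUnit q) (hf : evalAt v' θ' P.f = a * η)
    (hΔ : T * (evalAt v' θ' (derivative P.f) * evalCoeff v' P.w) ^ 2 = a * q)
    (hl : ∀ b ∈ P.gens, evalAt v' θ' (P.num b) *
      (T * evalAt v' θ' (derivative P.f) ^ 2 * evalCoeff v' P.w) = a * l b) :
    ∃ ψ : B →+* S, (∀ i, ψ (P.v i) = v' i) ∧ ψ (evalCoeff P.v P.w) ≠ 0 := by
  obtain ⟨u, rfl⟩ := hq
  let w : S := evalCoeff v' P.w
  let f' : S := evalAt v' θ' (derivative P.f)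
  have hΔ' : a = ↑u⁻¹ * (T * (f' * w) ^ 2) := by
    rw [hΔ, mul_comm a, Units.inv_mul_cancel_left]
  have hne : T * (f' * w) ^ 2 ≠ 0 := by
    rw [hΔ]; exact mul_ne_zero ha u.ne_zero
  have hT : T ≠ 0 := left_ne_zero_of_mul hne
  have hfw : f' * w ≠ 0 := fun h => hne (by simp [h])
  have hf' : f' ≠ 0 := left_ne_zero_of_mul hfw
  have hw : w ≠ 0 := right_ne_zero_of_mul hfw
  let φ : (MvPolynomial P.ι ℤ) →+* S := evalCoeff v'
  have hev : ∀ (t : S) (Q : (MvPolynomial P.ι ℤ)[X]), evalAt v' t Q = (Q.map φ).eval t := by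
    intro t Q
    rw [Polynomial.eval_map]; rfl
  let F : S[X][X] := (P.f.map φ).map C
  obtain ⟨ρ, hρ⟩ := F.binomExpansion (C θ') (C (f' * w) * X)
  have hF0 : F.eval (C θ') = C (a * η) := by
    rw [← hf, hev]
    simp only [F]
    rw [Polynomial.eval_map, eval₂_at_apply]
  have hF1 : (derivative F).eval (C θ') = C f' := by
    simp only [F, f']
    rw [hev, derivative_map, derivative_map, Polynomial.eval_map, eval₂_at_apply]
  let g : S[X] := X + C w * ρ * X ^ 2 + C (↑u⁻¹ * T * w * η)
  have hg : F.eval (C θ' + C (f' * w) * X) = C (f' ^ 2 * w) * g := by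
    rw [hρ, hF0, hF1, hΔ']
    simp only [g, C_mul, C_pow]
    ring
  obtain ⟨ζ, -, hζ⟩ := IsAdicComplete.exists_add_sq_mul_eval_add_eq_zero (Ideal.span {T})
    (C w * ρ) (t := ↑u⁻¹ * T * w * η) (Ideal.mem_span_singleton.mpr ⟨↑u⁻¹ * w * η, by ring⟩)
  have hroot : evalAt v' (θ' + f' * w * ζ) P.f = 0 := by
    have h1 := congrArg (eval ζ) hg
    have h2 : g.eval ζ = 0 := by
      rw [← hζ]
      simp only [g, eval_add, eval_mul, eval_C, eval_X, eval_pow]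
      ring
    rw [eval_mul, h2, mul_zero] at h1
    rw [hev, ← h1]
    have h3 : ∀ (Q : S[X]) (t : S[X]), eval ζ ((Q.map C).eval t) = Q.eval (eval ζ t) := by
      intro Q t
      rw [← coe_evalRingHom, ← eval₂_hom, ← Polynomial.eval_map, map_map]
      congr 1
      convert Polynomial.map_id
      ext; simp
    rw [h3]
    simp
  obtain ⟨ψ, hψ⟩ := P.exists_ringHom v' (θ' + f' * w * ζ) hroot hw (by
    intro b hb
    have h1 : w ∣ evalAt v' (θ' + f' * w * ζ) (P.num b) - evalAt v' θ' (P.num b) :=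
      dvd_evalAt_sub (by simp) ⟨f' * ζ, by ring⟩ _
    have h2 : evalAt v' θ' (P.num b) = w * (↑u⁻¹ * l b) := by
      have h3 := hl b hb
      rw [hΔ'] at h3
      have h4 : T * f' ^ 2 * w ≠ 0 := mul_ne_zero (mul_ne_zero hT (pow_ne_zero _ hf')) hw
      exact mul_right_cancel₀ h4 (h3.trans (by ring))
    have := dvd_add h1 (Dvd.intro _ h2.symm)
    rwa [sub_add_cancel] at this)
  refine ⟨ψ, hψ, ?_⟩
  rw [map_evalCoeff]
  simp only [hψ]
  exact hw

end Presentation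

section Weierstrass

open Polynomial

theorem Polynomial.IsDistinguishedAt.dvd_of_coe_dvd {R : Type*} [CommRing R] {I : Ideal R}
    (hI : I ≠ ⊤) [IsHausdorff I R] {a : R[X]} (ha : a.IsDistinguishedAt I) {Q : R[X]}
    (h : (a : PowerSeries R) ∣ (Q : PowerSeries R)) : a ∣ Q := by
  obtain ⟨t, ht⟩ := h
  rw [← modByMonic_eq_zero_iff_dvd ha.monic]
  have : Nontrivial R := ⟨⟨0, 1, fun h => hI ((Ideal.eq_top_iff_one I).mpr (h ▸ I.zero_mem))⟩⟩
  have hdiv := modByMonic_add_div Q a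
  have hdeg := degree_modByMonic_lt Q ha.monic
  set r := Q %ₘ a
  have hnat : a.natDegree = ((a : PowerSeries R).map (Ideal.Quotient.mk I)).order.toNat := by
    rw [← ha.coe_natDegree_eq_order_map (a : PowerSeries R) 1
      (by rwa [PowerSeries.constantCoeff_one, ← Ideal.ne_top_iff_one]) (by simp)]
    rfl
  refine (ha.isWeierstrassDivisorAt'.eq_zero_of_mul_eq
    (q := t - ((Q /ₘ a : R[X]) : PowerSeries R)) (r := r) ?_ ?_).2
  · rw [← hnat]
    exact hdeg.trans_le degree_le_natDegree
  · have := congrArg (fun p : R[X] => (p : PowerSeries R)) hdiv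
    simp only [coe_add, coe_mul] at this
    rw [mul_sub, ← ht, ← this]
    ring

theorem PrimitivePresentation.exists_polynomial_approx {R : Type*} [CommRing R] [IsDomain R]
    [IsLocalRing R] [IsAdicComplete (IsLocalRing.maximalIdeal R) R] {B : Type} [CommRing B]
    (P : PrimitivePresentation B) (φ : B →+* PowerSeries R)
    (hδ : (φ (evalAt P.v P.θ (derivative P.f) * evalCoeff P.v P.w)).map
      (IsLocalRing.residue R) ≠ 0) {κ : Type*} (j : κ → P.ι) (px : κ → R[X])
    (hx : ∀ i, φ (P.v (j i)) = px i) :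
    ∃ (v' : P.ι → R[X]) (θ' a η q : R[X]) (l : B → R[X]), a.Monic ∧ IsUnit (q.coeff 0) ∧
      (∀ i, v' (j i) = px i) ∧ evalAt v' θ' P.f = a * η ∧
      X * (evalAt v' θ' (derivative P.f) * evalCoeff v' P.w) ^ 2 = a * q ∧
      ∀ b ∈ P.gens, evalAt v' θ' (P.num b) *
        (X * evalAt v' θ' (derivative P.f) ^ 2 * evalCoeff v' P.w) = a * l b := by
  classical
  set δ := φ (evalAt P.v P.θ (derivative P.f) * evalCoeff P.v P.w) with hδdef
  have hg : (PowerSeries.X * δ ^ 2).map (IsLocalRing.residue R) ≠ 0 := by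
    rw [map_mul, map_pow, PowerSeries.map_X]
    exact mul_ne_zero PowerSeries.X_ne_zero (pow_ne_zero _ hδ)
  obtain ⟨a, h, H⟩ := PowerSeries.exists_isWeierstrassFactorization hg
  have ha := H.isDistinguishedAt
  have hdesc : ∀ Q : R[X], (a : PowerSeries R) ∣ Q → a ∣ Q := fun Q hQ =>
    ha.dvd_of_coe_dvd Ideal.IsPrime.ne_top' hQ
  have hred : ∀ y : PowerSeries R, ∃ y' : R[X], (a : PowerSeries R) ∣ y' - y := by
    intro y
    obtain ⟨q, r, hqr⟩ := PowerSeries.exists_isWeierstrassDivision y hg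
    refine ⟨r, -(h * q), ?_⟩
    have h1 := hqr.eq_mul_add
    have h2 := H.eq_mul
    rw [h1, h2]
    ring
  choose red hred using hred
  let v' : P.ι → R[X] := fun i => if hi : ∃ t, j t = i then px hi.choose else red (φ (P.v i))
  let θ' := red (φ P.θ)
  have hv'x : ∀ t, v' (j t) = px t := by
    intro t
    have hex : ∃ s, j s = j t := ⟨t, rfl⟩
    simp only [v', dif_pos hex]
    apply Polynomial.coe_injective
    rw [← hx, ← hx, hex.choose_spec]
  have hv' : ∀ i, (a : PowerSeries R) ∣ v' i - φ (P.v i) := by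
    intro i
    by_cases hi : ∃ t, j t = i
    · obtain ⟨t, rfl⟩ := hi
      rw [hv'x, hx, sub_self]
      exact dvd_zero _
    · simp only [v', dif_neg hi]
      exact hred _
  let c : R[X] →+* PowerSeries R := coeToPowerSeries.ringHom
  have hc : ∀ Q : R[X], (Q : PowerSeries R) = c Q := fun Q => rfl
  have hev : ∀ Q, (a : PowerSeries R) ∣ (evalAt v' θ' Q : R[X]) - φ (evalAt P.v P.θ Q) := by
    intro Q
    rw [hc (evalAt v' θ' Q), map_evalAt, map_evalAt]
    exact dvd_evalAt_sub hv' (hred _) Q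
  obtain ⟨η, hη⟩ := hdesc (evalAt v' θ' P.f) (by simpa [P.evalAt_f] using hev P.f)
  obtain ⟨e, he⟩ := hev (derivative P.f * C P.w)
  have hΔ : ((evalAt v' θ' (derivative P.f) * evalCoeff v' P.w : R[X]) : PowerSeries R) =
      δ + a * e := by
    rw [map_mul, map_mul, evalAt_C, evalAt_C, ← hδdef] at he
    exact sub_eq_iff_eq_add'.mp he
  have hXΔ : ((X * (evalAt v' θ' (derivative P.f) * evalCoeff v' P.w) ^ 2 : R[X]) :
      PowerSeries R) =
        (a : PowerSeries R) * (h + PowerSeries.X * (2 * δ * e + (a : PowerSeries R) * e ^ 2)) := by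
    rw [coe_mul, coe_pow, hΔ, coe_X, mul_add, ← H.eq_mul]
    ring
  obtain ⟨q, hq⟩ := hdesc _ ⟨_, hXΔ⟩
  have hl : ∀ b : B, ∃ l : R[X], b ∈ P.gens → evalAt v' θ' (P.num b) *
        (X * evalAt v' θ' (derivative P.f) ^ 2 * evalCoeff v' P.w) = a * l := by
    intro b
    by_cases hb : b ∈ P.gens
    · obtain ⟨e, he⟩ := hev (P.num b * (derivative P.f) ^ 2 * C P.w)
      obtain ⟨l, hl⟩ := hdesc (evalAt v' θ' (P.num b) *
        (X * evalAt v' θ' (derivative P.f) ^ 2 * evalCoeff v' P.w))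
        ⟨h * φ b + PowerSeries.X * e, by
          have h1 : (evalAt v' θ' (P.num b) * (X * evalAt v' θ' (derivative P.f) ^ 2 *
              evalCoeff v' P.w) : R[X]) = X * evalAt v' θ'
                (P.num b * (derivative P.f) ^ 2 * C P.w) := by
            rw [map_mul, map_mul, map_pow, evalAt_C]; ring
          have h2 : evalAt P.v P.θ (P.num b * (derivative P.f) ^ 2 * C P.w) =
              (evalAt P.v P.θ (derivative P.f) * evalCoeff P.v P.w) ^ 2 * b := by
            rw [map_mul, map_mul, map_pow, evalAt_C, ← P.mul_gen b hb]; ring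
          rw [h2, map_mul φ, map_pow φ, ← hδdef] at he
          rw [h1, coe_mul, coe_X]
          linear_combination PowerSeries.X * he + φ b * H.eq_mul⟩
      exact ⟨l, fun _ => hl⟩
    · exact ⟨0, fun h => absurd h hb⟩
  choose l hl using hl
  refine ⟨v', θ', a, η, q, l, ha.monic, ?_, hv'x, hη, hq, hl⟩
  have ha0 : (a : PowerSeries R) ≠ 0 := by
    intro h0
    exact ha.monic.ne_zero (Polynomial.coe_eq_zero_iff.mp h0)
  have hq' : (q : PowerSeries R) =
      h + PowerSeries.X * (2 * δ * e + (a : PowerSeries R) * e ^ 2) := by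
    apply mul_left_cancel₀ ha0
    rw [← hXΔ, hq, coe_mul]
  have hq0 : q.coeff 0 = PowerSeries.constantCoeff h := by
    rw [← Polynomial.coeff_coe, hq']
    simp
  rw [hq0]
  exact H.isUnit.map _

end Weierstrass

section Specialization

open Polynomial

/-- Finitely generated subrings of power series rings in `d` variables over a field of
characteristic zero specialize to power series rings over fields of positive characteristic. -/
def HasSpecialization (d : ℕ) : Prop :=
  ∀ (K : Type) [Field K] [CharZero K] (B : Type) [CommRing B] [Algebra.FiniteType ℤ B]
    (φ : B →+* MvPowerSeries (Fin d) K) (x : Fin d → B) (_ : ∀ i, φ (x i) = MvPowerSeries.X i)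
    (g : B) (_ : φ g ≠ 0),
    ∃ (p : ℕ) (_ : Fact p.Prime) (k : Type) (_ : Field k) (_ : CharP k p)
      (ψ : B →+* MvPowerSeries (Fin d) k), (∀ i, ψ (x i) = MvPowerSeries.X i) ∧ ψ g ≠ 0

theorem Polynomial.exists_adjoin_lifts {R : Type*} [CommRing R] (F : Set R[X]) (hF : F.Finite) :
    ∃ B : Subring R, Algebra.FiniteType ℤ B ∧ ∀ f ∈ F, ∃ g : B[X], g.map B.subtype = f := by
  classical
  let S : Finset R := hF.toFinset.biUnion fun f => f.coeffs
  refine ⟨(Algebra.adjoin ℤ (S : Set R)).toSubring, ?_, fun f hf => ?_⟩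
  · have := (Algebra.adjoin ℤ (S : Set R)).fg_iff_finiteType.mp ⟨S, rfl⟩
    refine Algebra.FiniteType.of_surjective (RingHom.toIntAlgHom
      (RingHom.id (Algebra.adjoin ℤ (S : Set R)) :
        Algebra.adjoin ℤ (S : Set R) →+* (Algebra.adjoin ℤ (S : Set R)).toSubring))
      fun b => ⟨b, rfl⟩
  have : f ∈ lifts (Algebra.adjoin ℤ (S : Set R)).toSubring.subtype := by
    rw [lifts_iff_coeff_lifts]
    intro n
    by_cases hn : f.coeff n = 0
    · exact ⟨0, by rw [hn, map_zero]⟩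
    · refine ⟨⟨f.coeff n, Algebra.subset_adjoin ?_⟩, rfl⟩
      exact Finset.mem_coe.mpr (Finset.mem_biUnion.mpr
        ⟨f, hF.mem_toFinset.mpr hf, coeff_mem_coeffs hn⟩)
  exact this

theorem MvPowerSeries.maximalIdeal_eq_span_range_X {σ k : Type*} [Finite σ] [Field k] :
    IsLocalRing.maximalIdeal (MvPowerSeries σ k) = Ideal.span (Set.range X) := by
  have := Fintype.ofFinite σ
  refine le_antisymm (fun f hf => ?_) ?_
  · have h := (mem_span_X_pow_iff (Finset.univ : Finset σ) 1 f).mpr fun m hm => by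
      have hm0 : m = 0 := by
        ext i
        simpa using hm i (Finset.mem_univ i)
      rw [IsLocalRing.mem_maximalIdeal, mem_nonunits_iff, isUnit_iff_constantCoeff,
        isUnit_iff_ne_zero, not_not] at hf
      rw [hm0, coeff_zero_eq_constantCoeff, hf]
    simpa using h
  · rw [Ideal.span_le]
    rintro _ ⟨i, rfl⟩
    rw [SetLike.mem_coe, IsLocalRing.mem_maximalIdeal, mem_nonunits_iff, isUnit_iff_constantCoeff]
    simp

instance MvPowerSeries.instIsDomain {σ k : Type*} [CommRing k] [IsDomain k] :
    IsDomain (MvPowerSeries σ k) :=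
  NoZeroDivisors.to_isDomain _

instance MvPowerSeries.isAdicComplete_maximalIdeal {σ k : Type*} [Finite σ] [Field k] :
    IsAdicComplete (IsLocalRing.maximalIdeal (MvPowerSeries σ k)) (MvPowerSeries σ k) := by
  rw [maximalIdeal_eq_span_range_X]
  infer_instance

theorem PrimitivePresentation.exists_specialization {d : ℕ} (hd : HasSpecialization d)
    {K : Type} [Field K] [CharZero K] {B : Type} [CommRing B] (P : PrimitivePresentation B)
    (φ : B →+* PowerSeries (MvPowerSeries (Fin d) K))
    (hδ : (φ (evalAt P.v P.θ (derivative P.f) * evalCoeff P.v P.w)).map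
      (IsLocalRing.residue (MvPowerSeries (Fin d) K)) ≠ 0) (j : Fin (d + 1) → P.ι)
    (n : Fin d → ℕ) (h0 : φ (P.v (j 0)) = PowerSeries.X)
    (hs : ∀ i, φ (P.v (j (Fin.succ i))) =
      PowerSeries.C (MvPowerSeries.X i) + PowerSeries.X ^ n i) :
    ∃ (p : ℕ) (_ : Fact p.Prime) (k : Type) (_ : Field k) (_ : CharP k p)
      (ψ : B →+* PowerSeries (MvPowerSeries (Fin d) k)),
      ψ (P.v (j 0)) = PowerSeries.X ∧
      (∀ i, ψ (P.v (j (Fin.succ i))) =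
        PowerSeries.C (MvPowerSeries.X i) + PowerSeries.X ^ n i) ∧
      ψ (evalCoeff P.v P.w) ≠ 0 := by
  classical
  have := P.finite_ι
  let px : Fin (d + 1) → (MvPowerSeries (Fin d) K)[X] :=
    Fin.cons X fun i => C (MvPowerSeries.X i) + X ^ n i
  obtain ⟨v', θ', a, η, q, l, ha, hq, hv', hf, hΔ, hl⟩ :=
    P.exists_polynomial_approx φ hδ j px (by
      intro i
      refine Fin.cases ?_ (fun i => ?_) i
      · simp [px, h0]
      · simp [px, hs])
  obtain ⟨q₀, hq₀⟩ := hq.exists_right_inv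
  obtain ⟨B', hB', hlift⟩ := Polynomial.exists_adjoin_lifts
    (Set.range v' ∪ {θ', a, η, q, C q₀} ∪ l '' P.gens ∪
      Set.range fun i : Fin d => C (MvPowerSeries.X i : MvPowerSeries (Fin d) K))
    (by
      refine ((((Set.finite_range v').union ?_).union ?_)).union (Set.finite_range _)
      · exact Set.toFinite _
      · exact P.gens.finite_toSet.image _)
  let c : B' →+* MvPowerSeries (Fin d) K := B'.subtype
  have hc : Function.Injective c := Subtype.val_injective
  have hcm : Function.Injective (Polynomial.map c) := Polynomial.map_injective c hc
  have hevm : ∀ (v : P.ι → B'[X]) (θ : B'[X]) (Q : _), (evalAt v θ Q).map c =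
      evalAt (fun i => (v i).map c) (θ.map c) Q := fun v θ Q => map_evalAt v θ (mapRingHom c) Q
  have hcoeffm : ∀ (v : P.ι → B'[X]) (Q : _), (evalCoeff v Q).map c =
      evalCoeff (fun i => (v i).map c) Q := fun v Q => map_evalCoeff v (mapRingHom c) Q
  choose v₁ hv₁ using fun i => hlift (v' i) (by simp)
  obtain ⟨θ₁, hθ₁⟩ := hlift θ' (by simp)
  obtain ⟨a₁, ha₁⟩ := hlift a (by simp)
  obtain ⟨η₁, hη₁⟩ := hlift η (by simp)
  obtain ⟨q₁, hq₁⟩ := hlift q (by simp)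
  obtain ⟨r₁, hr₁⟩ := hlift (C q₀) (by simp)
  choose x₁ hx₁ using fun i : Fin d => hlift (C (MvPowerSeries.X i)) (by simp)
  have hl₁ : ∀ b, ∃ l₁ : B'[X], b ∈ P.gens → l₁.map c = l b := by
    intro b
    by_cases hb : b ∈ P.gens
    · obtain ⟨l₁, h⟩ := hlift (l b) (Or.inl (Or.inr ⟨b, hb, rfl⟩))
      exact ⟨l₁, fun _ => h⟩
    · exact ⟨0, fun h => absurd h hb⟩
  choose l₁ hl₁ using hl₁
  have hv₁' : (fun i => (v₁ i).map c) = v' := funext hv₁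
  obtain ⟨p, hp, k, hk, hkp, χ₀, hχ₀, -⟩ := hd K B' c (fun i => (x₁ i).coeff 0) (by
    intro i
    rw [← coeff_map, hx₁, coeff_C_zero]) 1 (by simp)
  refine ⟨p, hp, k, hk, hkp, ?_⟩
  let χ : B'[X] →+* PowerSeries (MvPowerSeries (Fin d) k) :=
    coeToPowerSeries.ringHom.comp (mapRingHom χ₀)
  have hχ : ∀ Q, χ Q = ((Q.map χ₀ : (MvPowerSeries (Fin d) k)[X]) : PowerSeries _) :=
    fun Q => rfl
  have e1 : evalAt v₁ θ₁ P.f = a₁ * η₁ := hcm (by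
    rw [hevm, Polynomial.map_mul, hv₁', hθ₁, ha₁, hη₁, hf])
  have e2 : X * (evalAt v₁ θ₁ (derivative P.f) * evalCoeff v₁ P.w) ^ 2 = a₁ * q₁ := hcm (by
    rw [Polynomial.map_mul, Polynomial.map_pow, Polynomial.map_mul, hevm, hcoeffm, map_X,
      Polynomial.map_mul, hv₁', hθ₁, ha₁, hq₁, hΔ])
  have e3 : ∀ b ∈ P.gens, evalAt v₁ θ₁ (P.num b) *
      (X * evalAt v₁ θ₁ (derivative P.f) ^ 2 * evalCoeff v₁ P.w) = a₁ * l₁ b := fun b hb => hcm (by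
    rw [Polynomial.map_mul, Polynomial.map_mul, Polynomial.map_mul, Polynomial.map_pow, hevm, hevm,
      hcoeffm, map_X, Polynomial.map_mul, hv₁', hθ₁, ha₁, hl₁ b hb, hl b hb])
  have ha₁m : a₁.Monic := monic_of_injective hc (by rwa [ha₁])
  obtain ⟨ψ, hψ, hψw⟩ := P.exists_ringHom_of_approx (PowerSeries.X : PowerSeries
      (MvPowerSeries (Fin d) k)) (fun i => χ (v₁ i)) (χ θ₁) (χ a₁) (χ η₁) (χ q₁)
    (fun b => χ (l₁ b)) (by
      rw [hχ, Ne, Polynomial.coe_eq_zero_iff]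
      exact (ha₁m.map χ₀).ne_zero) (by
      rw [PowerSeries.isUnit_iff_constantCoeff, hχ, Polynomial.constantCoeff_coe, coeff_map]
      refine IsUnit.map χ₀ (IsUnit.of_mul_eq_one (r₁.coeff 0) (hc ?_))
      rw [map_mul, map_one, ← coeff_map, ← coeff_map, hq₁, hr₁, coeff_C_zero, hq₀]) (by
      rw [← map_evalAt, e1, map_mul]) (by
      rw [← map_evalAt, ← map_evalCoeff, ← map_mul χ a₁, ← e2, map_mul, map_pow, map_mul, hχ X]
      simp) (by
      intro b hb
      rw [← map_evalAt, ← map_evalAt, ← map_evalCoeff, ← map_mul χ a₁, ← e3 b hb, map_mul,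
        map_mul, map_mul, map_pow, hχ X]
      simp)
  refine ⟨ψ, ?_, fun i => ?_, hψw⟩
  · have : v₁ (j 0) = X := hcm (by simp only [map_X]; rw [hv₁, hv']; rfl)
    rw [hψ, this, hχ]
    simp
  · have : v₁ (j i.succ) = C ((x₁ i).coeff 0) + X ^ n i := hcm (by
      rw [hv₁, hv']
      simp only [Polynomial.map_add, map_C, Polynomial.map_pow, map_X]
      rw [← coeff_map, hx₁, coeff_C_zero]
      rfl)
    rw [hψ, this, hχ]
    simp [hχ₀]

end Specialization

section PrimitiveElement

open Polynomial

theorem Polynomial.exists_dvd_C_leadingCoeff_pow_mul {C B : Type*} [CommRing C] [IsDomain C]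
    [CommRing B] [Algebra C B] {θ : B} {f : C[X]} (hf : aeval θ f = 0)
    (hdeg : 0 < f.natDegree)
    (hmin : ∀ q : C[X], q ≠ 0 → aeval θ q = 0 → f.natDegree ≤ q.natDegree)
    (q : C[X]) (hq : aeval θ q = 0) : ∃ N : ℕ, f ∣ Polynomial.C f.leadingCoeff ^ N * q := by
  induction hn : q.natDegree using Nat.strong_induction_on generalizing q with
  | _ n ih =>
    by_cases hq0 : q = 0
    · exact ⟨0, by simp [hq0]⟩
    have hle := hmin q hq0 hq
    have hlt := natDegree_cancelLeads_lt_of_natDegree_le_natDegree hle (hdeg.trans_le hle)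
    have hc : f.cancelLeads q = Polynomial.C f.leadingCoeff * q -
        Polynomial.C q.leadingCoeff * X ^ (q.natDegree - f.natDegree) * f := by
      simp [cancelLeads, Nat.sub_eq_zero_of_le hle]
    obtain ⟨N, hN⟩ := ih _ (hn ▸ hlt) (f.cancelLeads q) (by rw [hc]; simp [hf, hq]) rfl
    refine ⟨N + 1, ?_⟩
    rw [hc, mul_sub] at hN
    have := hN.add (Dvd.intro_left (Polynomial.C f.leadingCoeff ^ N *
      (Polynomial.C q.leadingCoeff * X ^ (q.natDegree - f.natDegree))) rfl)
    refine this.trans (dvd_of_eq ?_)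
    ring

theorem Polynomial.exists_dvd_C_leadingCoeff_pow_mul_of_isAlgebraic {C B : Type*} [CommRing C]
    [IsDomain C] [CharZero C] [CommRing B] [Algebra C B]
    (hinj : Function.Injective (algebraMap C B)) {θ : B} (hθ : IsAlgebraic C θ) :
    ∃ f : C[X], f ≠ 0 ∧ aeval θ f = 0 ∧ aeval θ (derivative f) ≠ 0 ∧
      ∀ q : C[X], aeval θ q = 0 → ∃ N : ℕ, f ∣ Polynomial.C f.leadingCoeff ^ N * q := by
  classical
  have hex : ∃ n : ℕ, ∃ f : C[X], f ≠ 0 ∧ aeval θ f = 0 ∧ f.natDegree = n := by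
    obtain ⟨f, hf, hf0⟩ := hθ
    exact ⟨_, f, hf, hf0, rfl⟩
  obtain ⟨f, hf, hf0, hfn⟩ := Nat.find_spec hex
  have hmin : ∀ q : C[X], q ≠ 0 → aeval θ q = 0 → f.natDegree ≤ q.natDegree := fun q hq hq0 =>
    hfn ▸ Nat.find_min' hex ⟨q, hq, hq0, rfl⟩
  have hdeg : 0 < f.natDegree := by
    by_contra! h
    obtain ⟨c, rfl⟩ := natDegree_eq_zero.mp (Nat.le_zero.mp h)
    rw [aeval_C, map_eq_zero_iff _ hinj] at hf0
    exact hf (by rw [hf0, C_0])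
  refine ⟨f, hf, hf0, fun h => ?_, exists_dvd_C_leadingCoeff_pow_mul hf0 hdeg hmin⟩
  have h0 : derivative f ≠ 0 := fun h => hdeg.ne' (derivative_eq_zero.mp h)
  exact (natDegree_derivative_lt hdeg.ne').not_ge (hmin _ h0 h)

theorem Algebra.IsAlgebraic.exists_forall_mul_eq_aeval (C B : Type*) [CommRing C] [IsDomain C]
    [CharZero C] [CommRing B] [IsDomain B] [Algebra C B] [FaithfulSMul C B]
    [Algebra.IsAlgebraic C B] [Algebra.FiniteType C B] :
    ∃ θ : B, ∀ b : B, ∃ c : C, c ≠ 0 ∧ ∃ q : C[X], algebraMap C B c * b = aeval θ q := by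
  let F := FractionRing C
  let L := FractionRing B
  let : Algebra F L := FractionRing.liftAlgebra C L
  have : IsScalarTower C F L := FractionRing.isScalarTower_liftAlgebra C L
  have : Algebra.IsAlgebraic F L := by
    have := (IsFractionRing.isAlgebraic_iff' C B L).mp inferInstance
    exact Algebra.IsAlgebraic.extendScalars (R := C) (IsFractionRing.injective C F)
  have : Algebra.EssFiniteType B L := Algebra.EssFiniteType.of_isLocalization L (nonZeroDivisors B)
  have : Algebra.EssFiniteType C L := Algebra.EssFiniteType.comp C B L
  have : Algebra.EssFiniteType F L := Algebra.EssFiniteType.of_comp C F L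
  have : CharZero F := charZero_of_injective_algebraMap (IsFractionRing.injective C F)
  have : FiniteDimensional F L := Algebra.finite_of_essFiniteType_of_isAlgebraic
  obtain ⟨t, ht⟩ := Field.exists_primitive_element F L
  obtain ⟨⟨b, s⟩, hbs⟩ := IsLocalization.surj (nonZeroDivisors B) t
  obtain ⟨c, hc, a, ha⟩ := (Algebra.IsAlgebraic.isAlgebraic (R := C) (s : B)).exists_nonzero_dvd
    s.2
  refine ⟨b * a, fun x => ?_⟩
  have hθ : algebraMap B L (b * a) = algebraMap C F c • t := by
    rw [map_mul, ← hbs, mul_assoc, ← map_mul, ← ha, ← IsScalarTower.algebraMap_apply C B L,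
      Algebra.smul_def, ← IsScalarTower.algebraMap_apply C F L, mul_comm]
  have hx : algebraMap B L x ∈ Algebra.adjoin F {t} := by
    rw [IntermediateField.adjoin_eq_top_iff.mp ht]
    trivial
  have hle : Algebra.adjoin F {t} ≤ Algebra.adjoin F {algebraMap B L (b * a)} := by
    rw [Algebra.adjoin_le_iff, Set.singleton_subset_iff]
    have : t = (algebraMap C F c)⁻¹ • algebraMap B L (b * a) := by
      rw [hθ, smul_smul, inv_mul_cancel₀ (by simpa using hc), one_smul]
    rw [this]
    exact Subalgebra.smul_mem _ (Algebra.self_mem_adjoin_singleton F _) _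
  have hx' := hle hx
  rw [Algebra.adjoin_singleton_eq_range_aeval] at hx'
  obtain ⟨q, hq⟩ := hx'
  obtain ⟨e, he0, he⟩ := IsLocalization.integerNormalization_spec (nonZeroDivisors C) q
  refine ⟨e, nonZeroDivisors.ne_zero he0, IsLocalization.integerNormalization (nonZeroDivisors C) q,
    IsFractionRing.injective B L ?_⟩
  rw [map_mul, ← aeval_algebraMap_apply, ← hq, ← IsScalarTower.algebraMap_apply,
    ← aeval_map_algebraMap F, he]
  rw [← algebraMap_smul F e q, map_smul, Algebra.smul_def, ← IsScalarTower.algebraMap_apply]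
  rfl

theorem PrimitivePresentation.exists_of_algebraicIndependent (B : Type) [CommRing B] [IsDomain B]
    [CharZero B] [Algebra.FiniteType ℤ B] {κ : Type} [Finite κ] (x : κ → B)
    (hx : AlgebraicIndependent ℤ x) (g : B) (hg : g ≠ 0) :
    ∃ (P : PrimitivePresentation B) (j : κ → P.ι), (∀ i, P.v (j i) = x i) ∧
      evalAt P.v P.θ (derivative P.f) ≠ 0 ∧ evalCoeff P.v P.w ≠ 0 ∧ g ∣ evalCoeff P.v P.w := by
  classical
  obtain ⟨gens, hgens⟩ := (Algebra.FiniteType.out : (⊤ : Subalgebra ℤ B).FG)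
  have htop : Algebra.adjoin ℤ (Set.range x ∪ gens) = ⊤ :=
    top_le_iff.mp (hgens ▸ Algebra.adjoin_mono Set.subset_union_right)
  have : Algebra.IsAlgebraic (Algebra.adjoin ℤ (Set.range x ∪ gens)) B := by
    rw [htop]
    exact ⟨fun b => isAlgebraic_algebraMap (⟨b, trivial⟩ : (⊤ : Subalgebra ℤ B))⟩
  obtain ⟨u, hxu, hut, hu⟩ := exists_isTranscendenceBasis_between (R := ℤ) (Set.range x)
    (Set.range x ∪ gens) Set.subset_union_left hx.coe_range
  have hfin : Finite u := ((Set.finite_range x).union gens.finite_toSet).subset hut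
  let C := MvPolynomial u ℤ
  let v : u → B := (↑)
  have hinj : Function.Injective (evalCoeff v) := hu.1
  let : Algebra C B := (evalCoeff v).toAlgebra
  have : FaithfulSMul C B := (faithfulSMul_iff_algebraMap_injective C B).mpr hinj
  have : Algebra.IsAlgebraic C B := by
    have := hu.isAlgebraic
    exact .of_ringHom_of_comp_eq hu.1.aevalEquiv (RingHom.id B) hu.1.aevalEquiv.surjective
      Function.injective_id (RingHom.ext fun q => hu.1.algebraMap_aevalEquiv q)
  have : IsScalarTower ℤ C B := inferInstance
  have : Algebra.FiniteType C B := .of_restrictScalars_finiteType ℤ C B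
  obtain ⟨θ, hθ⟩ := Algebra.IsAlgebraic.exists_forall_mul_eq_aeval C B
  obtain ⟨f, hf, hf0, hfd, hdvd⟩ :=
    Polynomial.exists_dvd_C_leadingCoeff_pow_mul_of_isAlgebraic hinj
      (Algebra.IsAlgebraic.isAlgebraic (R := C) θ)
  choose c hc num hnum using hθ
  obtain ⟨e, he, a, ha⟩ := (Algebra.IsAlgebraic.isAlgebraic (R := C) g).exists_nonzero_dvd
    (mem_nonZeroDivisors_of_ne_zero hg)
  have hev : ∀ q : C[X], evalAt v θ q = aeval θ q := fun q => rfl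
  let w : C := f.leadingCoeff * (e * ∏ b ∈ gens, c b)
  have hw : w ≠ 0 := mul_ne_zero (leadingCoeff_ne_zero.mpr hf)
    (mul_ne_zero he (Finset.prod_ne_zero_iff.mpr fun b _ => hc b))
  refine ⟨{
    ι := u
    finite_ι := hfin
    v := v
    θ := θ
    f := f
    w := w
    gens := gens
    num := fun b => Polynomial.C (f.leadingCoeff * (e * ∏ b ∈ gens.erase b, c b)) * num b
    adjoin_gens := hgens
    evalAt_f := hf0
    dvd_of_evalAt_eq_zero := fun q hq => ?_
    mul_gen := fun b hb => ?_ }, fun i => ⟨x i, hxu ⟨i, rfl⟩⟩, fun i => rfl, hfd, ?_, ?_⟩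
  · obtain ⟨N, hN⟩ := hdvd q hq
    refine ⟨N, hN.trans ?_⟩
    rw [map_mul, mul_pow, mul_right_comm]
    exact Dvd.intro _ rfl
  · have h1 : w = f.leadingCoeff * (e * ∏ b ∈ gens.erase b, c b) * c b := by
      rw [mul_assoc, mul_assoc, Finset.prod_erase_mul gens c hb]
    rw [h1, map_mul (evalAt v θ), map_mul _ _ (c b), evalAt_C, hev, ← hnum, mul_assoc]
    rfl
  · exact fun h => hw (hinj (h.trans (map_zero _).symm))
  · refine (Dvd.intro a ha.symm).trans ?_
    exact map_dvd (evalCoeff v) ((Dvd.intro _ rfl : e ∣ e * _).mul_left _)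

end PrimitiveElement

section Shear

theorem exists_weight_unique_minimum {d : ℕ} (S : Set (Fin (d + 1) → ℕ)) (hS : S.Nonempty) :
    ∃ w : Fin (d + 1) → ℕ, w 0 = 1 ∧ (∀ i, 0 < w i) ∧
      ∃ e ∈ S, ∀ e' ∈ S, ∑ i, e' i * w i = ∑ i, e i * w i → e' = e := by
  suffices ∃ w : Fin (d + 1) → ℕ, w 0 = 1 ∧ (∀ i, 0 < w i) ∧
      ∃ e ∈ S, ∀ e' ∈ S, ∑ i, e' i * w i ≤ ∑ i, e i * w i → e' = e by
    obtain ⟨w, h0, hw, e, he, h⟩ := this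
    exact ⟨w, h0, hw, e, he, fun e' he' heq => h e' he' heq.le⟩
  induction d with
  | zero =>
    obtain ⟨e, he, hmin⟩ := exists_minimalFor_of_wellFoundedLT (· ∈ S) (fun e => e 0) hS
    refine ⟨fun _ => 1, rfl, fun _ => one_pos, e, he, fun e' he' hle => ?_⟩
    rw [Fin.sum_univ_one, Fin.sum_univ_one, mul_one, mul_one] at hle
    funext i
    rw [Fin.fin_one_eq_zero i]
    exact le_antisymm hle (hmin he' hle)
  | succ d ih =>
    obtain ⟨a, ha, hmin⟩ :=
      exists_minimalFor_of_wellFoundedLT (· ∈ S) (fun e => e (Fin.last (d + 1))) hS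
    obtain ⟨w, h0, hw, e, he, h⟩ := ih
      {e | (Fin.snoc e (a (Fin.last _)) : Fin (d + 2) → ℕ) ∈ S} (by
        refine ⟨Fin.init a, ?_⟩
        rw [Set.mem_ofPred_eq, Fin.snoc_init_self]
        exact ha)
    refine ⟨Fin.snoc w (1 + ∑ i, e i * w i), ?_, fun i => ?_, _, he,
      fun e' he' hle => ?_⟩
    · exact (Fin.snoc_castSucc (α := fun _ => ℕ) _ _ (0 : Fin (d + 1))).trans h0
    · refine Fin.lastCases ?_ (fun i => ?_) i
      · simp
      · simpa using hw i
    · rw [Fin.sum_univ_castSucc (n := d + 1), Fin.sum_univ_castSucc (n := d + 1)] at hle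
      simp only [Fin.snoc_castSucc, Fin.snoc_last] at hle
      have h1 : e' (Fin.last _) = a (Fin.last _) := by
        by_contra hne
        have : a (Fin.last _) ≤ e' (Fin.last _) := by
          by_contra! hlt
          exact hlt.not_ge (hmin he' hlt.le)
        have h2 : a (Fin.last _) + 1 ≤ e' (Fin.last _) := by omega
        have := Nat.mul_le_mul_right (1 + ∑ i, e i * w i) h2
        rw [add_mul] at this
        omega
      rw [h1] at hle
      have h2 := h (Fin.init e') (by
        rw [Set.mem_ofPred_eq, ← h1, Fin.snoc_init_self]
        exact he') (by simpa [Fin.init] using hle)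
      rw [← Fin.snoc_init_self e', h2, h1]

namespace MvPowerSeries

variable {d : ℕ} {k : Type*} [CommRing k]

/-- The point `(X₀, X₁ + c X₀ ^ n₁, …)` of the power series ring. -/
noncomputable def shearPoint (c : k) (n : Fin d → ℕ) (i : Fin (d + 1)) :
    MvPowerSeries (Fin (d + 1)) k :=
  Fin.cases (X 0) (fun i => X i.succ + C c * X 0 ^ n i) i

theorem hasSubst_shearPoint (c : k) {n : Fin d → ℕ} (hn : ∀ i, 0 < n i) :
    HasSubst (shearPoint c n) := by
  refine hasSubst_of_constantCoeff_zero fun i => ?_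
  refine Fin.cases ?_ (fun i => ?_) i
  · simp [shearPoint]
  · simp [shearPoint, (hn i).ne']

theorem substAlgHom_shearPoint_comp (c : k) {n : Fin d → ℕ} (hn : ∀ i, 0 < n i)
    (f : MvPowerSeries (Fin (d + 1)) k) :
    substAlgHom (R := k) (hasSubst_shearPoint (-c) hn)
      (substAlgHom (R := k) (hasSubst_shearPoint c hn) f) = f := by
  rw [coe_substAlgHom, coe_substAlgHom, subst_comp_subst_apply (hasSubst_shearPoint c hn)
    (hasSubst_shearPoint (-c) hn)]
  have : (fun i => subst (shearPoint (-c) n) (shearPoint c n i)) =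
      (X : Fin (d + 1) → MvPowerSeries (Fin (d + 1)) k) := by
    funext i
    rw [← coe_substAlgHom (R := k) (hasSubst_shearPoint (-c) hn)]
    refine Fin.cases ?_ (fun i => ?_) i
    · simp only [shearPoint, Fin.cases_zero, substAlgHom_X]
    · have hC : substAlgHom (R := k) (hasSubst_shearPoint (-c) hn) (C c) = C c :=
        (substAlgHom (R := k) (hasSubst_shearPoint (-c) hn)).commutes c
      simp only [shearPoint, Fin.cases_succ, map_add, map_mul, map_pow, substAlgHom_X,
        Fin.cases_zero]
      rw [hC]
      simp
  rw [this, subst_self, id]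

/-- Setting all variables but the first to zero. -/
noncomputable def restrictAxis (d : ℕ) (k : Type*) [CommRing k] :
    MvPowerSeries (Fin (d + 1)) k →+* PowerSeries k :=
  (PowerSeries.map constantCoeff).comp (finSuccEquiv k d).toRingEquiv.toRingHom

theorem coeff_restrictAxis (f : MvPowerSeries (Fin (d + 1)) k) (m : ℕ) :
    PowerSeries.coeff m (restrictAxis d k f) = coeff (Finsupp.cons m 0) f := by
  rw [restrictAxis, RingHom.comp_apply, PowerSeries.coeff_map, ← coeff_coeff_finSuccEquiv]
  rfl

theorem restrictAxis_shearPoint (n : Fin d → ℕ) (w : Fin (d + 1) → ℕ) (h0 : w 0 = 1)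
    (hw : ∀ i, w (Fin.succ i) = n i) (i : Fin (d + 1)) :
    restrictAxis d k (shearPoint 1 n i) = PowerSeries.X ^ w i := by
  refine Fin.cases ?_ (fun i => ?_) i
  · simp [shearPoint, restrictAxis, h0]
  · simp [shearPoint, restrictAxis, hw]

theorem exists_restrictAxis_substAlgHom_ne_zero (f : MvPowerSeries (Fin (d + 1)) k) (hf : f ≠ 0) :
    ∃ (n : Fin d → ℕ) (hn : ∀ i, 0 < n i),
      restrictAxis d k (substAlgHom (R := k) (hasSubst_shearPoint 1 hn) f) ≠ 0 := by
  obtain ⟨w, h0, hw, e, he, hmin⟩ := exists_weight_unique_minimum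
    {e : Fin (d + 1) → ℕ | coeff (Finsupp.equivFunOnFinite.symm e) f ≠ 0} (by
      by_contra! h
      refine hf (ext fun e => ?_)
      have := Set.eq_empty_iff_forall_notMem.mp h e
      simpa using this)
  refine ⟨fun i => w i.succ, fun i => hw _, fun h => he ?_⟩
  have key := congrArg (PowerSeries.coeff (∑ i, e i * w i)) h
  rw [coeff_restrictAxis, coe_substAlgHom, coeff_subst (hasSubst_shearPoint 1 fun i => hw _),
    finsum_eq_single _ (Finsupp.equivFunOnFinite.symm e)] at key
  · rw [← coeff_restrictAxis, Finsupp.prod_fintype _ _ (by simp), map_prod] at key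
    simp only [map_pow, restrictAxis_shearPoint _ w h0 fun i => rfl, ← pow_mul,
      Finset.prod_pow_eq_pow_sum] at key
    simpa [PowerSeries.coeff_X_pow, mul_comm] using key
  · intro a ha
    rw [← coeff_restrictAxis, Finsupp.prod_fintype _ _ (by simp), map_prod]
    simp only [map_pow, restrictAxis_shearPoint _ w h0 fun i => rfl, ← pow_mul,
      Finset.prod_pow_eq_pow_sum]
    by_cases h1 : coeff a f = 0
    · rw [h1, zero_smul]
    · rw [PowerSeries.coeff_X_pow, if_neg, smul_zero]
      intro h2
      refine ha ?_
      rw [← hmin a (by simpa using h1) (by simp only [h2, mul_comm (w _)])]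
      simp

end MvPowerSeries

end Shear

section SpecializationInduction

instance Int.instIsJacobsonRing : IsJacobsonRing ℤ := by
  rw [isJacobsonRing_iff_prime_eq]
  intro P hP
  by_cases h : P = ⊥
  · rw [h, eq_bot_iff]
    intro x hx
    have h1 := Int.isUnit_iff.mp (Ideal.mem_jacobson_bot.mp hx x)
    rw [Ideal.mem_bot]
    have h2 : x * x = 0 := by
      have := mul_self_nonneg x
      omega
    exact mul_self_eq_zero.mp h2
  · have := hP.isMaximal h
    exact Ideal.jacobson_eq_self_of_isMaximal

theorem exists_charP_of_finiteType_int (k : Type*) [Field k] [Algebra.FiniteType ℤ k] :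
    ∃ p : ℕ, p.Prime ∧ CharP k p := by
  obtain ⟨p, hp⟩ := CharP.exists k
  refine ⟨p, (CharP.char_is_prime_or_zero k p).resolve_right ?_, hp⟩
  rintro rfl
  have := CharP.charP_to_charZero k
  have : Module.Finite ℤ k := finite_of_finite_type_of_isJacobsonRing ℤ k
  exact Int.not_isField (isField_of_isIntegral_of_isField (R := ℤ) (S := k)
    (RingHom.injective_int (algebraMap ℤ k)) (Field.toIsField k))

theorem Algebra.FiniteType.int_of_surjective {A B : Type*} [CommRing A] [CommRing B]
    [Algebra.FiniteType ℤ A] (f : A →+* B) (hf : Function.Surjective f) :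
    Algebra.FiniteType ℤ B :=
  .of_surjective f.toIntAlgHom hf

theorem Algebra.FiniteType.int_trans {A B : Type*} [CommRing A] [CommRing B] [Algebra A B]
    [Algebra.FiniteType ℤ A] [Algebra.FiniteType A B] : Algebra.FiniteType ℤ B :=
  .trans (S := A) inferInstance inferInstance

theorem hasSpecialization_zero : HasSpecialization 0 := by
  intro K _ _ B _ _ φ x _ g hg
  have : Nontrivial (Localization.Away g) := by
    rw [← not_subsingleton_iff_nontrivial]
    intro h
    obtain ⟨⟨_, n, rfl⟩, hn⟩ := (IsLocalization.eq_iff_exists (Submonoid.powers g)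
      (Localization.Away g)).mp (Subsingleton.elim (algebraMap B _ 1) (algebraMap B _ 0))
    refine pow_ne_zero n hg ?_
    rw [← map_pow, ← map_zero φ]
    simpa using congrArg φ hn
  obtain ⟨m, hm⟩ := Ideal.exists_maximal (Localization.Away g)
  obtain ⟨p, hp, hk⟩ := @exists_charP_of_finiteType_int (Localization.Away g ⧸ m)
    (Ideal.Quotient.field m) (@Algebra.FiniteType.int_of_surjective (Localization.Away g) _ _ _
      (.int_trans (A := B)) (Ideal.Quotient.mk m) Ideal.Quotient.mk_surjective)
  refine ⟨p, ⟨hp⟩, Localization.Away g ⧸ m, Ideal.Quotient.field m, hk,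
    MvPowerSeries.C.comp ((Ideal.Quotient.mk m).comp (algebraMap B (Localization.Away g))),
    fun i => i.elim0, ?_⟩
  exact (((IsLocalization.Away.algebraMap_isUnit g).map (Ideal.Quotient.mk m)).map
    MvPowerSeries.C).ne_zero

theorem MvPowerSeries.algebraicIndependent_of_map_eq_X {σ K B : Type*} [Field K] [CharZero K]
    [CommRing B] (φ : B →+* MvPowerSeries σ K) (x : σ → B) (hx : ∀ i, φ (x i) = X i) :
    AlgebraicIndependent ℤ x := by
  have h : ∀ q : MvPolynomial σ ℤ, φ (MvPolynomial.aeval x q) =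
      ((MvPolynomial.map (Int.castRingHom K) q : MvPolynomial σ K) : MvPowerSeries σ K) := by
    intro q
    have : φ.comp (MvPolynomial.aeval x : MvPolynomial σ ℤ →ₐ[ℤ] B).toRingHom =
        MvPolynomial.coeToMvPowerSeries.ringHom.comp (MvPolynomial.map (Int.castRingHom K)) := by
      refine MvPolynomial.ringHom_ext (fun n => ?_) (fun i => ?_)
      · simp
      · simp [hx]
    exact DFunLike.congr_fun this q
  intro q₁ q₂ hq
  have := congrArg φ hq
  rw [h, h, MvPolynomial.coe_inj] at this
  exact MvPolynomial.map_injective _ (RingHom.injective_int _) this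

theorem MvPowerSeries.map_residue_finSuccEquiv_ne_zero {d : ℕ} {K : Type*} [Field K]
    {f : MvPowerSeries (Fin (d + 1)) K} (hf : restrictAxis d K f ≠ 0) :
    (finSuccEquiv K d f).map (IsLocalRing.residue (MvPowerSeries (Fin d) K)) ≠ 0 := by
  intro h
  refine hf (PowerSeries.ext fun n => ?_)
  have := congrArg (PowerSeries.coeff n) h
  rw [PowerSeries.coeff_map, map_zero, IsLocalRing.residue_eq_zero_iff,
    IsLocalRing.mem_maximalIdeal, mem_nonunits_iff, isUnit_iff_constantCoeff,
    isUnit_iff_ne_zero, not_not] at this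
  rw [map_zero, ← this]
  rfl

theorem HasSpecialization.succ {d : ℕ} (hd : HasSpecialization d) : HasSpecialization (d + 1) := by
  intro K _ _ B _ _ φ x hx g hg
  have : Algebra.FiniteType ℤ φ.range :=
    .of_surjective φ.rangeRestrict.toIntAlgHom φ.rangeRestrict_surjective
  have : CharZero φ.range := ⟨fun a b h => by
    have := congrArg φ.range.subtype h
    rw [map_natCast, map_natCast] at this
    have := congrArg MvPowerSeries.constantCoeff this
    rw [map_natCast, map_natCast] at this
    exact Nat.cast_injective (R := K) this⟩
  obtain ⟨P, j, hj, hPf, hPw, hgw⟩ := PrimitivePresentation.exists_of_algebraicIndependent φ.range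
    (fun i => φ.rangeRestrict (x i))
    (MvPowerSeries.algebraicIndependent_of_map_eq_X φ.range.subtype _ hx)
    (φ.rangeRestrict g) (fun h => hg (congrArg Subtype.val h))
  obtain ⟨n, hn, hne⟩ := MvPowerSeries.exists_restrictAxis_substAlgHom_ne_zero
    (φ.range.subtype (evalAt P.v P.θ (Polynomial.derivative P.f) * evalCoeff P.v P.w)) (by
      rw [map_ne_zero_iff _ (Subring.subtype_injective φ.range)]
      exact mul_ne_zero hPf hPw)
  have hsub : ∀ i, φ.range.subtype (P.v (j i)) = MvPowerSeries.X i := fun i => by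
    rw [hj, ← hx]
    rfl
  obtain ⟨p, hp, k, _, hk, ψ, hψ0, hψs, hψ⟩ := P.exists_specialization hd
    ((MvPowerSeries.finSuccEquiv K d).toRingEquiv.toRingHom.comp
      ((MvPowerSeries.substAlgHom (R := K)
        (MvPowerSeries.hasSubst_shearPoint 1 hn)).toRingHom.comp φ.range.subtype))
    (MvPowerSeries.map_residue_finSuccEquiv_ne_zero hne) j n
    (by
      change MvPowerSeries.finSuccEquiv K d (MvPowerSeries.substAlgHom
        (MvPowerSeries.hasSubst_shearPoint 1 hn) (φ.range.subtype _)) = _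
      simp only [hsub, MvPowerSeries.substAlgHom_X]
      simp [MvPowerSeries.shearPoint])
    (fun i => by
      change MvPowerSeries.finSuccEquiv K d (MvPowerSeries.substAlgHom
        (MvPowerSeries.hasSubst_shearPoint 1 hn) (φ.range.subtype _)) = _
      simp only [hsub, MvPowerSeries.substAlgHom_X]
      simp [MvPowerSeries.shearPoint])
  let τ := MvPowerSeries.substAlgHom (R := k) (MvPowerSeries.hasSubst_shearPoint (-1 : k) hn)
  have hτ : Function.Injective τ := by
    refine Function.LeftInverse.injective
      (g := MvPowerSeries.substAlgHom (R := k) (MvPowerSeries.hasSubst_shearPoint (- -1 : k) hn))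
      fun f => ?_
    exact MvPowerSeries.substAlgHom_shearPoint_comp (-1) hn f
  refine ⟨p, hp, k, inferInstance, hk, (τ.toRingHom.comp
    (MvPowerSeries.finSuccEquiv k d).symm.toRingEquiv.toRingHom).comp
      (ψ.comp φ.rangeRestrict), fun i => ?_, fun h => ?_⟩
  · change τ ((MvPowerSeries.finSuccEquiv k d).symm (ψ (φ.rangeRestrict (x i)))) = _
    rw [← hj]
    refine Fin.cases ?_ (fun i => ?_) i
    · rw [hψ0, ← MvPowerSeries.finSuccEquiv_X_zero, AlgEquiv.symm_apply_apply]
      simp only [τ, MvPowerSeries.substAlgHom_X]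
      simp [MvPowerSeries.shearPoint]
    · rw [hψs, ← MvPowerSeries.finSuccEquiv_X_zero, ← MvPowerSeries.finSuccEquiv_X_succ,
        ← map_pow, ← map_add, AlgEquiv.symm_apply_apply]
      simp only [τ, map_add, map_pow, MvPowerSeries.substAlgHom_X]
      simp [MvPowerSeries.shearPoint]
  · have h0 : ψ (φ.rangeRestrict g) = 0 :=
      (MvPowerSeries.finSuccEquiv k d).symm.injective (hτ (by
        rw [map_zero, map_zero]
        exact h))
    exact hψ (zero_dvd_iff.mp (h0 ▸ map_dvd ψ hgw))

theorem hasSpecialization (d : ℕ) : HasSpecialization d := by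
  induction d with
  | zero => exact hasSpecialization_zero
  | succ d ih => exact ih.succ

end SpecializationInduction

section Descent

open TensorProduct

namespace ChaseData

variable {D : Type*} [CommRing D] {r : ℕ} {y : ℕ → D}

/-- The relevant matrix and vector entries of chase data. -/
def entries (S : ChaseData D r y) : Set D :=
  (⋃ i, ⋃ j, {S.d i j, S.e i j}) ∪ (⋃ l : Fin r, ⋃ i, ⋃ j, {S.h l i j}) ∪
    ((⋃ l : Fin (r + 1), ⋃ i, {S.zs l i}) ∪ ⋃ i, {S.v i})

theorem finite_entries (S : ChaseData D r y) : S.entries.Finite := by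
  refine .union (.union ?_ ?_) (.union ?_ ?_)
  · exact Set.finite_iUnion fun i => Set.finite_iUnion fun j => by simp
  · exact Set.finite_iUnion fun l => Set.finite_iUnion fun i => Set.finite_iUnion fun j => by simp
  · exact Set.finite_iUnion fun l => Set.finite_iUnion fun i => by simp
  · exact Set.finite_iUnion fun i => by simp

variable (S : ChaseData D r y) {D' : Type*} [CommRing D'] (f : D' →+* D) (L : D → D')

theorem map_lift_d (hL : ∀ t ∈ S.entries, f (L t) = t) : (S.d.map L).map f = S.d := by
  ext i j
  exact hL _ (by simp only [entries, Set.mem_union, Set.mem_iUnion]; left; left; exact ⟨i, j, by simp⟩)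

theorem map_lift_e (hL : ∀ t ∈ S.entries, f (L t) = t) : (S.e.map L).map f = S.e := by
  ext i j
  exact hL _ (by simp only [entries, Set.mem_union, Set.mem_iUnion]; left; left; exact ⟨i, j, by simp⟩)

theorem map_lift_h (hL : ∀ t ∈ S.entries, f (L t) = t)
    (l : ℕ) (hl : l < r) : ((S.h l).map L).map f = S.h l := by
  ext i j
  exact hL _ (by
    simp only [entries, Set.mem_union, Set.mem_iUnion]
    left; right; exact ⟨⟨l, hl⟩, i, j, by simp⟩)

theorem map_lift_zs (hL : ∀ t ∈ S.entries, f (L t) = t)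
    (l : ℕ) (hl : l ≤ r) : f ∘ L ∘ S.zs l = S.zs l := by
  ext i
  exact hL _ (by
    simp only [entries, Set.mem_union, Set.mem_iUnion]
    right; left; exact ⟨⟨l, by omega⟩, i, by simp⟩)

theorem map_lift_v (hL : ∀ t ∈ S.entries, f (L t) = t) : f ∘ L ∘ S.v = S.v := by
  ext i
  exact hL _ (by
    simp only [entries, Set.mem_union, Set.mem_iUnion]
    right; right; exact ⟨i, by simp⟩)

/-- Chase data descend to a subring containing all entries. -/
def lift (hL : ∀ t ∈ S.entries, f (L t) = t)
    (hf : Function.Injective f) (y' : ℕ → D') (hy' : ∀ l < r, f (y' l) = y l) :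
    ChaseData D' r y' where
  n := S.n
  d := S.d.map L
  e := S.e.map L
  h l := (S.h l).map L
  zs l := L ∘ S.zs l
  v := L ∘ S.v
  d_sq := Matrix.map_injective hf (by
    beta_reduce
    rw [Matrix.map_mul, S.map_lift_d f L hL, S.d_sq]; ext; simp)
  e_h l hl := Matrix.map_injective hf (by
    beta_reduce
    rw [Matrix.map_mul, S.map_lift_e f L hL, S.map_lift_h f L hL l hl, S.e_h l hl])
  homotopy l hl := Matrix.map_injective hf (by
    beta_reduce
    rw [Matrix.map_add f (map_add f), Matrix.map_mul, Matrix.map_mul, S.map_lift_d f L hL,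
      S.map_lift_h f L hL l hl, S.homotopy l hl, ← hy' l hl]
    conv_lhs => rw [← S.map_lift_e f L hL]
    ext; simp)
  e_z := hf.comp_left (by
    beta_reduce
    funext i
    rw [Function.comp_apply, RingHom.map_mulVec, S.map_lift_e f L hL,
      S.map_lift_zs f L hL 0 (Nat.zero_le _), S.e_z])
  d_z := hf.comp_left (by
    beta_reduce
    funext i
    rw [Function.comp_apply, RingHom.map_mulVec, S.map_lift_d f L hL,
      S.map_lift_zs f L hL 0 (Nat.zero_le _), S.d_z]
    simp)
  zs_succ l hl := hf.comp_left (by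
    beta_reduce
    funext i
    rw [S.map_lift_zs f L hL (l + 1) hl, Function.comp_apply, RingHom.map_mulVec,
      S.map_lift_h f L hL l hl, S.map_lift_zs f L hL l hl.le, S.zs_succ l hl])
  zs_last := hf.comp_left (by
    beta_reduce
    rw [S.map_lift_zs f L hL r le_rfl, S.zs_last]; ext; simp)
  v_z := hf (by
    rw [RingHom.map_dotProduct, S.map_lift_zs f L hL 0 (Nat.zero_le _), S.map_lift_v f L hL, S.v_z,
      map_one])

theorem map_lift_u (hL : ∀ t ∈ S.entries, f (L t) = t)
    (hf : Function.Injective f) (y' : ℕ → D') (hy' : ∀ l < r, f (y' l) = y l)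
    (i : Fin S.n) : f ((S.lift f L hL hf y' hy').u i) = S.u i := by
  change f (Matrix.vecMul (L ∘ S.v) (S.d.map L) i) = _
  rw [RingHom.map_vecMul, S.map_lift_d f L hL, S.map_lift_v f L hL, u]

end ChaseData

theorem Subring.exists_finiteType_int_of_finite {R : Type*} [CommRing R] (Y : Set R)
    (hY : Y.Finite) : ∃ B : Subring R, Algebra.FiniteType ℤ B ∧ Y ⊆ B := by
  obtain ⟨B, hB, hlift⟩ := Polynomial.exists_adjoin_lifts (Polynomial.C '' Y) (hY.image _)
  refine ⟨B, hB, fun y hy => ?_⟩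
  obtain ⟨g, hg⟩ := hlift _ ⟨y, hy, rfl⟩
  have := congrArg (fun q => q.coeff 0) hg
  simp only [Polynomial.coeff_map, Polynomial.coeff_C_zero] at this
  exact this ▸ (g.coeff 0).2

theorem Subalgebra.exists_descent {R D : Type*} [CommRing R] [CommRing D] [Algebra R D]
    [Module.Finite R D] {N : ℕ} (α : D →ₗ[R] Fin N → R) (β : (Fin N → R) →ₗ[R] D)
    (Y : Set R) (hY : Y.Finite) (T : Set D) (hT : T.Finite) :
    ∃ B : Subring R, Algebra.FiniteType ℤ B ∧ Y ⊆ B ∧ ∃ D' : Subalgebra B D, T ⊆ D' ∧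
      (∀ w ∈ D', ∀ i, α w i ∈ B) ∧ ∀ i, β (Pi.single i 1) ∈ D' := by
  classical
  obtain ⟨m, e, he⟩ := Module.Finite.exists_fin (R := R) (M := D)
  have hrep : ∀ t : D, ∃ a : Fin m → R, ∑ k, a k • e k = t := fun t =>
    (Submodule.mem_span_range_iff_exists_fun R).mp (he ▸ Submodule.mem_top)
  choose rep hrep using hrep
  let T' : Set D := insert 1 (T ∪ (Set.range fun ij : Fin m × Fin m => e ij.1 * e ij.2) ∪
    Set.range fun i => β (Pi.single i 1))
  have hT' : T'.Finite := ((hT.union (Set.finite_range _)).union (Set.finite_range _)).insert 1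
  let Y' : Set R := Y ∪ (⋃ t ∈ T', Set.range (rep t)) ∪
    Set.range fun ki : Fin m × Fin N => α (e ki.1) ki.2
  have hY' : Y'.Finite := (hY.union (hT'.biUnion fun t _ => Set.finite_range _)).union
    (Set.finite_range _)
  obtain ⟨B, hB, hYB⟩ := Subring.exists_finiteType_int_of_finite Y' hY'
  have hspan : ∀ t ∈ T', t ∈ Submodule.span B (Set.range e) := by
    intro t ht
    rw [← hrep t]
    refine Submodule.sum_mem _ fun k _ => ?_
    have hk : rep t k ∈ B := hYB (.inl (.inr (Set.mem_biUnion ht ⟨k, rfl⟩)))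
    exact Submodule.smul_mem _ (⟨_, hk⟩ : B) (Submodule.subset_span ⟨k, rfl⟩)
  refine ⟨B, hB, fun y hy => hYB (.inl (.inl hy)), (Submodule.span B (Set.range e)).toSubalgebra
    (hspan 1 (.inl rfl)) (fun a b ha hb => ?_), fun t ht => hspan t (.inr (.inl (.inl ht))),
    fun w hw i => ?_, fun i => hspan _ (.inr (.inr ⟨i, rfl⟩))⟩
  · have hle : Submodule.span B (Set.range e) * Submodule.span B (Set.range e) ≤
        Submodule.span B (Set.range e) := by
      rw [Submodule.span_mul_span, Submodule.span_le]
      rintro _ ⟨_, ⟨i, rfl⟩, _, ⟨j, rfl⟩, rfl⟩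
      exact hspan _ (.inr (.inl (.inr ⟨(i, j), rfl⟩)))
    exact hle (Submodule.mul_mem_mul ha hb)
  · change w ∈ Submodule.span B (Set.range e) at hw
    induction hw using Submodule.span_induction with
    | mem x hx =>
      obtain ⟨k, rfl⟩ := hx
      exact hYB (.inr ⟨(k, i), rfl⟩)
    | zero => rw [map_zero]; exact B.zero_mem
    | add x y _ _ hx hy => rw [map_add]; exact B.add_mem hx hy
    | smul b x _ hx =>
      rw [show b • x = (b : R) • x from rfl, map_smul]
      exact B.mul_mem b.2 hx

end Descent

section CharZero

open TensorProduct MvPowerSeries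

/-- The restriction of a linear map into a free module to a subalgebra over a subring. -/
def Subalgebra.restrictToPi {R D : Type*} [CommRing R] [CommRing D] [Algebra R D] {N : ℕ}
    (α : D →ₗ[R] Fin N → R) (B : Subring R) (D' : Subalgebra B D)
    (h : ∀ w ∈ D', ∀ i, α w i ∈ B) : D' →ₗ[B] Fin N → B where
  toFun w i := ⟨α w i, h w w.2 i⟩
  map_add' w w' := by
    ext i
    simp
  map_smul' b w := by
    ext i
    have : ((b • w : D') : D) = (b : R) • (w : D) := rfl
    simp [this]

theorem Subalgebra.exists_restrictFromPi {R D : Type*} [CommRing R] [CommRing D] [Algebra R D]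
    {N : ℕ} (β : (Fin N → R) →ₗ[R] D) (B : Subring R) (D' : Subalgebra B D)
    (h : ∀ i, β (Pi.single i 1) ∈ D') :
    ∃ β' : (Fin N → B) →ₗ[B] D', ∀ a, (β' a : D) = β (fun i => (a i : R)) := by
  refine ⟨Fintype.linearCombination B fun i => (⟨_, h i⟩ : D'), fun a => ?_⟩
  rw [Fintype.linearCombination_apply, AddSubmonoidClass.coe_finsetSum]
  conv_rhs => rw [LinearMap.pi_apply_eq_sum_univ β]
  refine Finset.sum_congr rfl fun i _ => ?_
  have : (Pi.single i 1 : Fin N → R) = fun j => if i = j then 1 else 0 := by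
    ext j; simp [Pi.single_apply, eq_comm]
  rw [← this]
  rfl

theorem ChaseData.false_of_charZero {K : Type} [Field K] [CharZero K] {d r N M a : ℕ} (hr : r ≤ d)
    {D : Type} [CommRing D] [Algebra (MvPowerSeries (Fin d) K) D]
    [Module.Finite (MvPowerSeries (Fin d) K) D]
    (α : D →ₗ[MvPowerSeries (Fin d) K] Fin N → MvPowerSeries (Fin d) K)
    (β : (Fin N → MvPowerSeries (Fin d) K) →ₗ[MvPowerSeries (Fin d) K] D)
    (c : MvPowerSeries (Fin d) K) (hβ : ∀ w, β (α w) = c • w) (i₀ : Fin N)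
    (hne : c * α 1 i₀ ≠ 0) {y : ℕ → D} (S : ChaseData D r y)
    (hy : ∀ l (hl : l < r), y l = algebraMap (MvPowerSeries (Fin d) K) D
      (X ⟨l, hl.trans_le hr⟩ ^ M))
    (hu : ∀ j, S.u j ^ a ∈ (Ideal.span (Set.range (X : Fin d → MvPowerSeries (Fin d) K))).map
      (algebraMap (MvPowerSeries (Fin d) K) D)) : False := by
  classical
  have hw : ∀ j, ∃ w : Fin d → D, ∑ l, w l * algebraMap (MvPowerSeries (Fin d) K) D (X l) =
      S.u j ^ a := by
    intro j
    have := hu j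
    rw [Ideal.map_span, ← Set.range_comp, Ideal.mem_span_range_iff_exists_fun] at this
    exact this
  choose w hw using hw
  obtain ⟨B, hB, hYB, D', hTD, hαD, hβD⟩ := Subalgebra.exists_descent α β
    (Set.range X ∪ {c}) ((Set.finite_range _).union (Set.finite_singleton _))
    (S.entries ∪ Set.range fun jl : Fin S.n × Fin d => w jl.1 jl.2)
    (S.finite_entries.union (Set.finite_range _))
  let αB := Subalgebra.restrictToPi α B D' hαD
  obtain ⟨βB, hβB⟩ := Subalgebra.exists_restrictFromPi β B D' hβD
  let cB : B := ⟨c, hYB (.inr rfl)⟩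
  let xB : Fin d → B := fun i => ⟨X i, hYB (.inl ⟨i, rfl⟩)⟩
  have hβαB : ∀ t, βB (αB t) = cB • t := fun t => Subtype.ext ((hβB _).trans (hβ t))
  have hne' : B.subtype (cB * αB 1 i₀) ≠ 0 := hne
  let L : D → D' := fun t => if h : t ∈ D' then ⟨t, h⟩ else 0
  have hLval : ∀ t ∈ D', (L t : D) = t := fun t ht => by simp [L, ht]
  let wB : Fin S.n → Fin d → D' := fun j l => ⟨w j l, hTD (.inr ⟨(j, l), rfl⟩)⟩
  let yB : ℕ → D' := fun l => if h : l < r then algebraMap B D' (xB ⟨l, h.trans_le hr⟩ ^ M) else 0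
  have hyB : ∀ l < r, D'.val.toRingHom (yB l) = y l := by
    intro l hl
    rw [hy l hl]
    simp only [yB, hl, dif_pos]
    rfl
  let SB := S.lift D'.val.toRingHom L (fun t ht => hLval t (hTD (.inl ht))) Subtype.val_injective
    yB hyB
  have huB : ∀ j, SB.u j ^ a = ∑ l, wB j l * algebraMap B D' (xB l) := by
    intro j
    apply Subtype.val_injective
    have h1 : ((SB.u j : D') : D) = S.u j := S.map_lift_u D'.val.toRingHom L _ _ yB hyB j
    rw [SubmonoidClass.coe_pow, h1, ← hw j, AddSubmonoidClass.coe_finsetSum]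
    rfl
  obtain ⟨p, hp, k, _, _, ψ, hψX, hψ⟩ := hasSpecialization d K B B.subtype xB (fun i => rfl)
    (cB * αB 1 i₀) hne'
  let _ : Algebra B (MvPowerSeries (Fin d) k) := ψ.toAlgebra
  let Rk := MvPowerSeries (Fin d) k
  let αk : Rk ⊗[B] D' →ₗ[Rk] Fin N → Rk :=
    (TensorProduct.piScalarRight B Rk Rk (Fin N)).toLinearMap ∘ₗ αB.baseChange Rk
  let βk : (Fin N → Rk) →ₗ[Rk] Rk ⊗[B] D' :=
    βB.baseChange Rk ∘ₗ (TensorProduct.piScalarRight B Rk Rk (Fin N)).symm.toLinearMap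
  have hβk : ∀ t, βk (αk t) = ψ cB • t := by
    intro t
    simp only [αk, βk, LinearMap.comp_apply, LinearEquiv.coe_coe, LinearEquiv.symm_apply_apply]
    induction t with
    | zero => simp
    | add x y hx hy => rw [map_add, map_add, hx, hy, smul_add]
    | tmul x t =>
      rw [LinearMap.baseChange_tmul, LinearMap.baseChange_tmul, hβαB, ← TensorProduct.smul_tmul,
        TensorProduct.smul_tmul', Algebra.smul_def, smul_eq_mul]
      rfl
  have hα1 : αk 1 i₀ = ψ (αB 1 i₀) := by
    simp only [αk, LinearMap.comp_apply, LinearEquiv.coe_coe, Algebra.TensorProduct.one_def,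
      LinearMap.baseChange_tmul, TensorProduct.piScalarRight_apply,
      TensorProduct.piScalarRightHom_tmul, Algebra.smul_def, mul_one]
    rfl
  have halg : ∀ b : B, (Algebra.TensorProduct.includeRight : D' →ₐ[B] Rk ⊗[B] D')
      (algebraMap B D' b) = algebraMap Rk (Rk ⊗[B] D') (ψ b) := by
    intro b
    rw [AlgHom.commutes, IsScalarTower.algebraMap_apply B Rk (Rk ⊗[B] D')]
    rfl
  have key := ChaseData.pow_mul_eq_zero (M := M) (a := a) p hr αk βk (ψ cB) hβk i₀
    (SB.map (Algebra.TensorProduct.includeRight : D' →ₐ[B] Rk ⊗[B] D').toRingHom) (by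
      intro l hl
      simp only [Function.comp_apply, yB, hl, dif_pos]
      refine (halg _).trans ?_
      rw [map_pow, hψX]) (by
      intro j
      have h1 := congrArg (· ^ a) (SB.map_u
        (Algebra.TensorProduct.includeRight : D' →ₐ[B] Rk ⊗[B] D').toRingHom j)
      have h2 := h1.trans ((map_pow _ _ a).symm.trans ((congrArg
        (Algebra.TensorProduct.includeRight : D' →ₐ[B] Rk ⊗[B] D').toRingHom (huB j)).trans
          (map_sum _ _ _)))
      refine h2 ▸ Ideal.sum_mem _ fun l _ => ?_
      rw [map_mul]
      refine Ideal.mul_mem_left _ _ ?_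
      refine (halg (xB l)).symm ▸ ?_
      rw [hψX]
      exact Ideal.mem_map_of_mem _ (Ideal.subset_span ⟨l, rfl⟩))
  rw [hα1] at key
  rw [map_mul] at hψ
  exact mul_ne_zero (pow_ne_zero _ (left_ne_zero_of_mul hψ)) (right_ne_zero_of_mul hψ) key

end CharZero

section AlgebraicComplex

variable {A : Type*} [CommRing A]

/-- A `ℕ`-indexed chain complex of modules, in terms of its underlying linear maps. -/
structure ModuleChain.{v, u} (A : Type u) [CommRing A] where
  M : ℕ → Type v
  [addCommGroup : ∀ i, AddCommGroup (M i)]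
  [module : ∀ i, Module A (M i)]
  d : ∀ i, M (i + 1) →ₗ[A] M i
  d_comp_d : ∀ i x, d i (d (i + 1) x) = 0

namespace ModuleChain

attribute [instance] addCommGroup module

variable (C : ModuleChain A)

/-- The cycles of degree `j`. -/
def cycles : ∀ j, Submodule A (C.M j)
  | 0 => ⊤
  | j + 1 => LinearMap.ker (C.d j)

/-- The composite `E_i → E_{i-1} → E_i` of the differential and a map of degree one. -/
def hd (h : ∀ i, C.M i →ₗ[A] C.M (i + 1)) : ∀ i, C.M i →ₗ[A] C.M i
  | 0 => 0
  | i + 1 => h i ∘ₗ C.d i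

variable {C}

theorem d_mem_cycles : ∀ (j : ℕ) (x : C.M (j + 1)), C.d j x ∈ C.cycles j
  | 0, _ => trivial
  | j + 1, x => C.d_comp_d j x

theorem hd_eq_zero_of_mem_cycles (h : ∀ i, C.M i →ₗ[A] C.M (i + 1)) :
    ∀ (j : ℕ) (z : C.M j), z ∈ C.cycles j → C.hd h j z = 0
  | 0, _, _ => rfl
  | j + 1, z, hz => by
    change h j (C.d j z) = 0
    rw [show C.d j z = 0 from hz, map_zero]

/-- `h` is a homotopy between `u` and zero in degree `i`. -/
def IsHomotopyAt (C : ModuleChain A) (u : A) (h : ∀ i, C.M i →ₗ[A] C.M (i + 1)) (i : ℕ) : Prop :=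
  ∀ x, C.d i (h i x) + C.hd h i x = u • x

theorem hd_smul (a : A) (h : ∀ i, C.M i →ₗ[A] C.M (i + 1)) (i : ℕ) (x : C.M i) :
    C.hd (fun j => a • h j) i x = a • C.hd h i x := by
  cases i <;> simp [hd]

theorem IsHomotopyAt.smul {u : A} {h : ∀ i, C.M i →ₗ[A] C.M (i + 1)} {i : ℕ}
    (H : C.IsHomotopyAt u h i) (a : A) : C.IsHomotopyAt (a * u) (fun j => a • h j) i := by
  intro x
  rw [hd_smul, LinearMap.smul_apply, map_smul, ← smul_add, H x, mul_smul]

/-- A partial homotopy gives an approximate projection onto cycles in the next degree. -/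
theorem smul_sub_hd_mem_cycles {u : A} {h : ∀ i, C.M i →ₗ[A] C.M (i + 1)} {n : ℕ}
    (H : ∀ i < n, C.IsHomotopyAt u h i) (x : C.M n) : u • x - C.hd h n x ∈ C.cycles n := by
  cases n with
  | zero => trivial
  | succ n =>
    change C.d n (u • x - h n (C.d n x)) = 0
    have := H n n.lt_succ_self (C.d n x)
    rw [hd_eq_zero_of_mem_cycles h n _ (d_mem_cycles n x), add_zero] at this
    rw [map_sub, map_smul, this, sub_self]

theorem hd_congr {h h' : ∀ i, C.M i →ₗ[A] C.M (i + 1)} {n : ℕ} (hh : ∀ i < n, h i = h' i) :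
    C.hd h n = C.hd h' n := by
  cases n with
  | zero => rfl
  | succ n => simp [hd, hh n n.lt_succ_self]

theorem exists_homotopy [∀ i, Module.Projective A (C.M i)] (U : Submonoid A) (n : ℕ)
    (hU : ∀ j < n, ∃ u ∈ U, ∀ z ∈ C.cycles j, ∃ w, C.d j w = u • z) :
    ∃ u ∈ U, ∃ h : ∀ i, C.M i →ₗ[A] C.M (i + 1), ∀ i < n, C.IsHomotopyAt u h i := by
  classical
  induction n with
  | zero => exact ⟨1, U.one_mem, fun _ => 0, by simp⟩
  | succ n ih =>
    obtain ⟨u, hu, h, H⟩ := ih fun j hj => hU j (hj.trans n.lt_succ_self)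
    obtain ⟨w, hw, hwz⟩ := hU n n.lt_succ_self
    let g : C.M n →ₗ[A] LinearMap.range (C.d n) :=
      (w • (u • LinearMap.id - C.hd h n)).codRestrict _ fun x =>
        hwz _ (smul_sub_hd_mem_cycles H x)
    obtain ⟨k, hk⟩ := Module.projective_lifting_property (C.d n).rangeRestrict g
      (LinearMap.surjective_rangeRestrict _)
    have hk' : ∀ x, C.d n (k x) = w • (u • x - C.hd h n x) := fun x =>
      congrArg Subtype.val (LinearMap.congr_fun hk x)
    let h' : ∀ i, C.M i →ₗ[A] C.M (i + 1) := Function.update (fun i => w • h i) n k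
    have h'lt : ∀ i < n, h' i = w • h i := fun i hi => Function.update_of_ne hi.ne _ _
    refine ⟨w * u, U.mul_mem hw hu, h', fun i hi x => ?_⟩
    rcases Nat.lt_succ_iff_lt_or_eq.mp hi with hi | rfl
    · rw [hd_congr fun j hj => h'lt j (hj.trans hi), h'lt i hi]
      exact (H i hi).smul w x
    · rw [hd_congr h'lt, hd_smul, show h' i = k from Function.update_self _ _ _, hk', smul_sub,
        mul_smul, sub_add_cancel]

/-- The modules of boundaries and of multiples of cycles by `p` are proper, in a strong sense, in
each degree where the annihilator of homology is contained in `p`. -/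
theorem exists_cycle [IsNoetherianRing A] [∀ i, Module.Finite A (C.M i)] (p : Ideal A)
    [p.IsPrime] (j : ℕ) (hp : ∀ u, (∀ z ∈ C.cycles j, ∃ w, C.d j w = u • z) → u ∈ p) :
    ∃ z ∈ C.cycles j, ∀ t ∉ p, t • z ∉ LinearMap.range (C.d j) ⊔ p • C.cycles j := by
  by_contra! hcon
  have hcom : ∃ t ∉ p, ∀ z ∈ C.cycles j, t • z ∈ LinearMap.range (C.d j) ⊔ p • C.cycles j := by
    obtain ⟨T, hT⟩ := IsNoetherian.noetherian (C.cycles j)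
    choose! t ht htz using hcon
    refine ⟨∏ z ∈ T, t z, ?_, fun z hz => ?_⟩
    · rw [Ideal.IsPrime.prod_mem_iff]
      rintro ⟨z, hz, h⟩
      exact ht z (hT ▸ Submodule.subset_span hz) h
    · rw [← hT] at hz
      induction hz using Submodule.span_induction with
      | mem z hz =>
        classical
        rw [← Finset.prod_erase_mul T t hz, mul_smul]
        exact Submodule.smul_mem _ _ (htz z (hT ▸ Submodule.subset_span hz))
      | zero => rw [smul_zero]; exact Submodule.zero_mem _
      | add x y _ _ hx hy => rw [smul_add]; exact Submodule.add_mem _ hx hy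
      | smul a x _ hx => rw [smul_comm]; exact Submodule.smul_mem _ _ hx
  obtain ⟨t, ht, htz⟩ := hcom
  let Q := C.cycles j ⧸ (LinearMap.range (C.d j)).comap (C.cycles j).subtype
  have hrange : LinearMap.range (t • (LinearMap.id : Q →ₗ[A] Q)) ≤ p • ⊤ := by
    rintro _ ⟨q, rfl⟩
    obtain ⟨z, rfl⟩ := Submodule.mkQ_surjective _ q
    obtain ⟨b, ⟨w, hw⟩, c, hc, hbc⟩ := Submodule.mem_sup.mp (htz z z.2)
    have hc' : c ∈ (p • (⊤ : Submodule A (C.cycles j))).map (C.cycles j).subtype := by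
      rwa [Submodule.map_smul'', Submodule.map_subtype_top]
    obtain ⟨c', hc', rfl⟩ := hc'
    have hq : (t • (LinearMap.id : Q →ₗ[A] Q)) (Submodule.mkQ _ z) = Submodule.mkQ _ c' := by
      rw [LinearMap.smul_apply, LinearMap.id_apply, ← map_smul, ← sub_eq_zero, ← map_sub,
        ← LinearMap.mem_ker, Submodule.ker_mkQ]
      exact ⟨w, by simp [hw, ← hbc]⟩
    rw [hq]
    have := Submodule.mem_map_of_mem (f := Submodule.mkQ
      ((LinearMap.range (C.d j)).comap (C.cycles j).subtype)) hc'
    rw [Submodule.map_smul''] at this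
    exact Submodule.smul_mono le_rfl le_top this
  obtain ⟨P, hPm, -, hPc, hP⟩ :=
    LinearMap.exists_monic_and_natDegree_eq_and_coeff_mem_pow_and_aeval_eq_zero A _ _ hrange
  have hann : ∀ q : Q, P.eval t • q = 0 := by
    intro q
    have h1 : (t • (LinearMap.id : Q →ₗ[A] Q)) = algebraMap A (Module.End A Q) t := rfl
    rw [h1, Polynomial.aeval_algebraMap_apply_eq_algebraMap_eval] at hP
    exact LinearMap.congr_fun hP q
  have hmem : P.eval t ∈ p := hp _ fun z hz => by
    have := hann (Submodule.mkQ _ ⟨z, hz⟩)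
    rw [← map_smul, ← LinearMap.mem_ker, Submodule.ker_mkQ] at this
    exact this
  rw [Polynomial.eval_eq_sum_range, Finset.sum_range_succ, hPm.coeff_natDegree, one_mul,
    Ideal.add_mem_iff_right] at hmem
  · exact ht (Ideal.IsPrime.mem_of_pow_mem inferInstance _ hmem)
  · refine Ideal.sum_mem _ fun k hk => Ideal.mul_mem_right _ _ ?_
    exact Ideal.pow_le_self (Nat.sub_ne_zero_of_lt (Finset.mem_range.mp hk)) (hPc k)

end ModuleChain
end AlgebraicComplex

section OfComplex

variable {A : Type*} [CommRing A]

theorem CategoryTheory.ShortComplex.moduleCat_smul_homology_eq_zero_iff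
    (S : ShortComplex (ModuleCat A)) (u : A) :
    (∀ x : S.homology, u • x = 0) ↔ ∀ z : S.X₂, S.g z = 0 → ∃ w, S.f w = u • z := by
  have e : S.homology ≃ₗ[A] (LinearMap.ker S.g.hom ⧸ LinearMap.range S.moduleCatToCycles) :=
    S.moduleCatHomologyIso.toLinearEquiv
  have h1 : (∀ x : S.homology, u • x = 0) ↔
      ∀ x : (LinearMap.ker S.g.hom ⧸ LinearMap.range S.moduleCatToCycles), u • x = 0 := by
    refine ⟨fun h x => ?_, fun h x => ?_⟩
    · rw [← e.apply_symm_apply x, ← map_smul, h, map_zero]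
    · rw [← e.symm_apply_apply x, ← map_smul, h, map_zero]
  rw [h1]
  refine ⟨fun h z hz => ?_, fun h x => ?_⟩
  · have := h (Submodule.Quotient.mk ⟨z, hz⟩)
    rw [← Submodule.Quotient.mk_smul, Submodule.Quotient.mk_eq_zero] at this
    obtain ⟨w, hw⟩ := this
    exact ⟨w, congrArg Subtype.val hw⟩
  · obtain ⟨z, rfl⟩ := Submodule.Quotient.mk_surjective _ x
    rw [← Submodule.Quotient.mk_smul, Submodule.Quotient.mk_eq_zero]
    obtain ⟨w, hw⟩ := h z.1 z.2
    exact ⟨w, Subtype.ext hw⟩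

namespace ModuleChain

/-- The underlying linear maps of a chain complex of modules. -/
def ofComplex (E : ChainComplex (ModuleCat A) ℕ) : ModuleChain A where
  M i := E.X i
  d i := (E.d (i + 1) i).hom
  d_comp_d i x := by
    have := congrArg (fun f => f.hom x) (E.d_comp_d (i + 1 + 1) (i + 1) i)
    exact this

theorem mem_cycles_ofComplex (E : ChainComplex (ModuleCat A) ℕ) (i : ℕ)
    (z : (ofComplex E).M i) :
    z ∈ (ofComplex E).cycles i ↔ E.d i ((ComplexShape.down ℕ).next i) z = 0 := by
  cases i with
  | zero =>
    have : E.d 0 ((ComplexShape.down ℕ).next 0) = 0 := E.shape _ _ (by simp)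
    rw [this]
    exact ⟨fun _ => rfl, fun _ => trivial⟩
  | succ i =>
    rw [ChainComplex.next_nat_succ]
    exact Iff.rfl

theorem mem_annihilator_homology_iff (E : ChainComplex (ModuleCat A) ℕ) (i : ℕ) (u : A) :
    u ∈ Module.annihilator A (E.homology i) ↔
      ∀ z ∈ (ofComplex E).cycles i, ∃ w, (ofComplex E).d i w = u • z := by
  rw [Module.mem_annihilator]
  let e : E.homology i ≅ (E.sc' (i + 1) i ((ComplexShape.down ℕ).next i)).homology :=
    ShortComplex.homologyMapIso (E.isoSc' (i + 1) i _ (ChainComplex.prev ℕ i) rfl)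
  have h1 : (∀ x : E.homology i, u • x = 0) ↔
      ∀ x : (E.sc' (i + 1) i ((ComplexShape.down ℕ).next i)).homology, u • x = 0 := by
    refine ⟨fun h x => ?_, fun h x => ?_⟩
    · rw [← e.toLinearEquiv.apply_symm_apply x, ← map_smul, h, map_zero]
    · rw [← e.toLinearEquiv.symm_apply_apply x, ← map_smul, h, map_zero]
  rw [h1, ShortComplex.moduleCat_smul_homology_eq_zero_iff]
  exact forall_congr' fun z => imp_congr_left (mem_cycles_ofComplex E i z).symm

theorem finite_homology [IsNoetherianRing A] (E : ChainComplex (ModuleCat A) ℕ) (i : ℕ)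
    [Module.Finite A (E.X i)] : Module.Finite A (E.homology i) := by
  have : Module.Finite A (E.sc i).X₂ := ‹Module.Finite A (E.X i)›
  have h : Module.Finite A (LinearMap.ker (E.sc i).g.hom ⧸
    LinearMap.range (E.sc i).moduleCatToCycles) := inferInstance
  have h' : Module.Finite A (E.sc i).moduleCatLeftHomologyData.H := h
  exact Module.Finite.equiv ((E.sc i).moduleCatHomologyIso.toLinearEquiv.symm)

theorem mem_support_homology_iff [IsNoetherianRing A] (E : ChainComplex (ModuleCat A) ℕ)
    (i : ℕ) [Module.Finite A (E.X i)] (p : PrimeSpectrum A) :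
    p ∈ Module.support A (E.homology i) ↔ Module.annihilator A (E.homology i) ≤ p.asIdeal := by
  have := finite_homology E i
  exact Module.mem_support_iff_of_finite

end ModuleChain
end OfComplex

section Functional

variable {A : Type*} [CommRing A]

theorem Ideal.ResidueField.exists_smul_eq (p : Ideal A) [p.IsPrime] (a : p.ResidueField) :
    ∃ t ∉ p, ∃ b : A, t • a = algebraMap A p.ResidueField b := by
  obtain ⟨b, s, hs, rfl⟩ := IsFractionRing.div_surjective (A := A ⧸ p) a
  obtain ⟨b, rfl⟩ := Ideal.Quotient.mk_surjective b
  obtain ⟨s, rfl⟩ := Ideal.Quotient.mk_surjective s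
  have hs' : Ideal.Quotient.mk p s ≠ 0 := nonZeroDivisors.ne_zero hs
  refine ⟨s, fun h => hs' (Ideal.Quotient.eq_zero_iff_mem.mpr h), b, ?_⟩
  have h0 : algebraMap (A ⧸ p) p.ResidueField (Ideal.Quotient.mk p s) ≠ 0 := by
    simpa [Ideal.Quotient.eq_zero_iff_mem] using hs'
  rw [Algebra.smul_def, IsScalarTower.algebraMap_apply A (A ⧸ p) p.ResidueField,
    IsScalarTower.algebraMap_apply A (A ⧸ p) p.ResidueField]
  exact mul_div_cancel₀ _ h0

theorem Ideal.exists_dotProduct_notMem (p : Ideal A) [p.IsPrime] {n : ℕ} (z : Fin n → A)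
    (F : (Fin n → A) →ₗ[A] (Fin n → A)) (h : ∀ t ∉ p, ∀ w, ¬ ∀ i, (t • z - F w) i ∈ p) :
    ∃ v : Fin n → A, v ⬝ᵥ z ∉ p ∧ ∀ w, v ⬝ᵥ F w ∈ p := by
  classical
  let κ := p.ResidueField
  let ρ : (Fin n → A) →ₗ[A] (Fin n → κ) := (Algebra.linearMap A κ).compLeft (Fin n)
  have hker : ∀ y, ρ y = 0 → ∀ i, y i ∈ p := fun y hy i =>
    Ideal.algebraMap_residueField_eq_zero.mp (congrFun hy i)
  let N : Submodule κ (Fin n → κ) := Submodule.span κ (Set.range (ρ ∘ F))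
  have hN : ∀ y ∈ N, ∃ t ∉ p, ∃ w, t • y = ρ (F w) := by
    intro y hy
    induction hy using Submodule.span_induction with
    | mem y hy =>
      obtain ⟨w, rfl⟩ := hy
      exact ⟨1, (Ideal.ne_top_iff_one p).mp Ideal.IsPrime.ne_top', w, one_smul _ _⟩
    | zero => exact ⟨1, (Ideal.ne_top_iff_one p).mp Ideal.IsPrime.ne_top', 0, by simp⟩
    | add x y _ _ hx hy =>
      obtain ⟨t, ht, w, hw⟩ := hx
      obtain ⟨t', ht', w', hw'⟩ := hy
      refine ⟨t * t', p.primeCompl.mul_mem ht ht', t' • w + t • w', ?_⟩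
      rw [map_add, map_add, map_smul, map_smul, map_smul, map_smul, ← hw, ← hw', smul_add,
        mul_comm, mul_smul, mul_comm, mul_smul]
    | smul a x _ hx =>
      obtain ⟨t, ht, w, hw⟩ := hx
      obtain ⟨t', ht', b, hb⟩ := Ideal.ResidueField.exists_smul_eq p a
      refine ⟨t' * t, p.primeCompl.mul_mem ht' ht, b • w, ?_⟩
      rw [map_smul, map_smul, ← hw, mul_smul, smul_comm t a x, ← smul_assoc, hb,
        algebraMap_smul]
  have hz : ρ z ∉ N := by
    intro hz
    obtain ⟨t, ht, w, hw⟩ := hN _ hz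
    refine h t ht w (hker _ ?_)
    rw [map_sub, map_smul, hw, sub_self]
  obtain ⟨f, hfz, hfN⟩ := Submodule.exists_le_ker_of_notMem hz
  choose t ht b hb using fun i => Ideal.ResidueField.exists_smul_eq p (f (Pi.single i 1))
  let T := ∏ i, t i
  have hT : T ∉ p := by
    rw [Ideal.IsPrime.prod_mem_iff]
    rintro ⟨i, -, hi⟩
    exact ht i hi
  let v : Fin n → A := fun i => (∏ j ∈ Finset.univ.erase i, t j) * b i
  have hv : ∀ y, algebraMap A κ (v ⬝ᵥ y) = algebraMap A κ T * f (ρ y) := by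
    intro y
    rw [LinearMap.pi_apply_eq_sum_univ f (ρ y), dotProduct, map_sum, Finset.mul_sum]
    refine Finset.sum_congr rfl fun i _ => ?_
    have h1 : (fun j => if i = j then 1 else 0 : Fin n → κ) = Pi.single i 1 := by
      ext j; simp [Pi.single_apply, eq_comm]
    have h2 : T = (∏ j ∈ Finset.univ.erase i, t j) * t i :=
      (Finset.prod_erase_mul _ _ (Finset.mem_univ i)).symm
    have h3 := hb i
    rw [Algebra.smul_def] at h3
    rw [h1, h2, map_mul, map_mul, map_mul, ← h3, smul_eq_mul]
    simp only [ρ, LinearMap.compLeft_apply, Function.comp_apply, Algebra.linearMap_apply]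
    ring
  refine ⟨v, fun hmem => ?_, fun w => ?_⟩
  · rw [← Ideal.algebraMap_residueField_eq_zero, hv] at hmem
    exact hfz ((mul_eq_zero.mp hmem).resolve_left
      fun h0 => hT (Ideal.algebraMap_residueField_eq_zero.mp h0))
  · rw [← Ideal.algebraMap_residueField_eq_zero, hv]
    rw [show f (ρ (F w)) = 0 from hfN (Submodule.subset_span ⟨w, rfl⟩), mul_zero]

end Functional

section Total

variable {A : Type*} [CommRing A]

theorem ChaseData.exists_of_linearMap (p : Ideal A) {D : Type*} [CommRing D] (f : A →+* D)
    (hf : ∀ t ∉ p, IsUnit (f t)) {n r : ℕ} (F Q : (Fin n → A) →ₗ[A] (Fin n → A))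
    (G : ℕ → (Fin n → A) →ₗ[A] (Fin n → A)) (x t : ℕ → A) (M : ℕ) (zs : ℕ → Fin n → A)
    (v : Fin n → A) (hF : F ∘ₗ F = 0) (hQG : ∀ l < r, Q ∘ₗ G l = G l)
    (hG : ∀ l < r, F ∘ₗ G l + G l ∘ₗ F = (t l * x l ^ M) • Q) (ht : ∀ l, t l ∉ p)
    (hQz : Q (zs 0) = zs 0) (hFz : F (zs 0) = 0) (hzs : ∀ l, zs (l + 1) = G l (zs l))
    (hlast : zs r = 0) (hvz : v ⬝ᵥ zs 0 ∉ p) (hvF : ∀ w, v ⬝ᵥ F w ∈ p) :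
    ∃ S : ChaseData D r (fun l => f (x l) ^ M), ∀ k, S.u k ∈ p.map f := by
  classical
  choose τ hτ using fun l => (hf (t l) (ht l)).exists_right_inv
  obtain ⟨ω, hω⟩ := (hf _ hvz).exists_right_inv
  let mat : ((Fin n → A) →ₗ[A] (Fin n → A)) → Matrix (Fin n) (Fin n) D := fun L =>
    (LinearMap.toMatrix' L).map f
  have mat_comp : ∀ L L', mat L * mat L' = mat (L ∘ₗ L') := fun L L' => by
    simp only [mat, LinearMap.toMatrix'_comp, Matrix.map_mul]
  have mat_mulVec : ∀ L y, (mat L).mulVec (f ∘ y) = f ∘ L y := fun L y => by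
    funext i
    rw [← RingHom.map_mulVec, Function.comp_apply, LinearMap.toMatrix'_mulVec]
  have mat_add : ∀ L L', mat L + mat L' = mat (L + L') := fun L L' => by
    ext i j; simp [mat]
  have mat_smul : ∀ (a : A) L, mat (a • L) = f a • mat L := fun a L => by
    ext i j; simp [mat]
  refine ⟨{
    n := n
    d := mat F
    e := mat Q
    h := fun l => τ l • mat (G l)
    zs := fun l => (∏ k ∈ Finset.range l, τ k) • (f ∘ zs l)
    v := ω • (f ∘ v)
    d_sq := by rw [mat_comp, hF]; ext; simp [mat]
    e_h := fun l hl => by rw [Matrix.mul_smul, mat_comp, hQG l hl]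
    homotopy := fun l hl => by
      rw [Matrix.mul_smul, Matrix.smul_mul, ← smul_add, mat_comp, mat_comp, mat_add, hG l hl,
        mat_smul, smul_smul, map_mul, map_pow, ← mul_assoc, mul_comm (τ l), hτ, one_mul]
    e_z := by simp [mat_mulVec, hQz]
    d_z := by
      simp only [Finset.range_zero, Finset.prod_empty, one_smul, mat_mulVec, hFz]
      ext; simp
    zs_succ := fun l _ => by
      rw [Matrix.smul_mulVec, Matrix.mulVec_smul, mat_mulVec, hzs, Finset.prod_range_succ, smul_smul,
        mul_comm]
    zs_last := by rw [hlast]; ext; simp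
    v_z := by
      rw [Finset.range_zero, Finset.prod_empty, one_smul, smul_dotProduct, ← RingHom.map_dotProduct,
        smul_eq_mul, mul_comm, hω] }, fun k => ?_⟩
  change Matrix.vecMul (ω • (f ∘ v)) (mat F) k ∈ p.map f
  have hk : Matrix.vecMul (f ∘ v) (mat F) k = f (v ⬝ᵥ F (Pi.single k 1)) := by
    rw [← RingHom.map_vecMul]
    refine congrArg f (congrArg (v ⬝ᵥ ·) ?_)
    funext i
    rfl
  rw [Matrix.smul_vecMul, Pi.smul_apply, hk]
  exact Ideal.mul_mem_left _ _ (Ideal.mem_map_of_mem f (hvF _))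

namespace ModuleChain

variable (C : ModuleChain A)

/-- The total differential. -/
def totalD : (∀ i, C.M i) →ₗ[A] (∀ i, C.M i) :=
  LinearMap.pi fun i => C.d i ∘ₗ LinearMap.proj (i + 1)

variable {C} in
/-- The total map of a family of maps of degree one. -/
def totalH (h : ∀ i, C.M i →ₗ[A] C.M (i + 1)) : (∀ i, C.M i) →ₗ[A] (∀ i, C.M i) :=
  LinearMap.pi fun
    | 0 => 0
    | i + 1 => h i ∘ₗ LinearMap.proj i

theorem totalD_totalD (x : ∀ i, C.M i) : C.totalD (C.totalD x) = 0 :=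
  funext fun i => C.d_comp_d i _

variable {C}

theorem totalD_totalH_add {u : A} {h : ∀ i, C.M i →ₗ[A] C.M (i + 1)}
    (H : ∀ i, C.IsHomotopyAt u h i) (x : ∀ i, C.M i) :
    C.totalD (totalH h x) + totalH h (C.totalD x) = u • x := by
  funext i
  rw [Pi.smul_apply, ← H i (x i)]
  cases i <;> rfl

theorem totalD_single {j : ℕ} {z : C.M j} (hz : z ∈ C.cycles j) :
    C.totalD (Pi.single j z) = 0 := by
  funext i
  change C.d i (Pi.single j z (i + 1) : C.M (i + 1)) = 0
  by_cases hij : i + 1 = j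
  · subst hij
    rw [Pi.single_eq_same]
    exact hz
  · rw [Pi.single_eq_of_ne hij, map_zero]

theorem totalH_apply_eq_zero (h : ∀ i, C.M i →ₗ[A] C.M (i + 1)) {x : ∀ i, C.M i} {j : ℕ}
    (hx : ∀ i < j, x i = 0) : ∀ i < j + 1, totalH h x i = 0 := by
  intro i hi
  cases i with
  | zero => rfl
  | succ i =>
    change h i (x i) = 0
    rw [hx i (by omega), map_zero]

section Bounded

variable {s : ℕ} (hC : ∀ i, s < i → Subsingleton (C.M i))

/-- The total module of a bounded complex as a finite product. -/
def totalEquiv : (∀ i, C.M i) ≃ₗ[A] (∀ i : Fin (s + 1), C.M i) where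
  toFun x i := x i
  invFun x i := if h : i < s + 1 then x ⟨i, h⟩ else 0
  map_add' _ _ := rfl
  map_smul' _ _ := rfl
  left_inv x := by
    funext i
    by_cases h : i < s + 1
    · simp [h]
    · have := hC i (by omega)
      exact Subsingleton.elim _ _
  right_inv x := by
    funext i
    exact dif_pos i.2

theorem finite_total (hC : ∀ i, s < i → Subsingleton (C.M i)) [∀ i, Module.Finite A (C.M i)] :
    Module.Finite A (∀ i, C.M i) :=
  Module.Finite.equiv (totalEquiv hC).symm

theorem projective_total (hC : ∀ i, s < i → Subsingleton (C.M i))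
    [∀ i, Module.Projective A (C.M i)] : Module.Projective A (∀ i, C.M i) :=
  have : Module.Projective A (∀ i : Fin (s + 1), C.M i) :=
    Module.Projective.of_equiv (DFinsupp.linearEquivFunOnFintype (R := A)
      (M := fun i : Fin (s + 1) => C.M i))
  Module.Projective.of_equiv (totalEquiv hC).symm

theorem isHomotopyAt_of_subsingleton (u : A) (h : ∀ i, C.M i →ₗ[A] C.M (i + 1)) {i : ℕ}
    (hi : Subsingleton (C.M i)) : C.IsHomotopyAt u h i := fun _ => Subsingleton.elim _ _

end Bounded

/-- Chase data over a localization-like algebra, from a bounded complex of finite projective modules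
whose homology has `p` as a minimal point of its support. -/
theorem exists_chaseData [IsNoetherianRing A] [∀ i, Module.Finite A (C.M i)]
    [∀ i, Module.Projective A (C.M i)] {s : ℕ} (hC : ∀ i, s < i → Subsingleton (C.M i))
    (p : Ideal A) [p.IsPrime] {j : ℕ}
    (hj : ∀ u, (∀ z ∈ C.cycles j, ∃ w, C.d j w = u • z) → u ∈ p)
    (hlt : ∀ i < j, ∃ u ∉ p, ∀ z ∈ C.cycles i, ∃ w, C.d i w = u • z)
    (hann : ∀ x ∈ p, ∀ i, ∃ t ∉ p, ∃ N : ℕ, ∀ z ∈ C.cycles i, ∃ w, C.d i w = (t * x ^ N) • z)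
    {D : Type*} [CommRing D] (f : A →+* D) (hf : ∀ t ∉ p, IsUnit (f t)) (x : ℕ → A)
    (hx : ∀ l, x l ∈ p) :
    ∃ M, ∃ S : ChaseData D (s + 1) (fun l => f (x l) ^ M), ∀ k, S.u k ∈ p.map f := by
  classical
  have := finite_total hC
  have := projective_total hC
  obtain ⟨n, π, ι, -, -, hπι⟩ := Module.Finite.exists_comp_eq_id_of_projective A (∀ i, C.M i)
  have hπι : ∀ y, π (ι y) = y := LinearMap.congr_fun hπι
  -- the cycle and the covector
  obtain ⟨z, hz, hzt⟩ := C.exists_cycle p j hj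
  obtain ⟨t₀, ht₀, h₀, H₀⟩ := C.exists_homotopy p.primeCompl j hlt
  let pr : C.M j →ₗ[A] C.cycles j := (t₀ • LinearMap.id - C.hd h₀ j).codRestrict _
    fun y => smul_sub_hd_mem_cycles H₀ y
  have hpr : ∀ y ∈ C.cycles j, (pr y : C.M j) = t₀ • y := fun y hy => by
    change t₀ • y - C.hd h₀ j y = _
    rw [hd_eq_zero_of_mem_cycles _ _ _ hy, sub_zero]
  let F : (Fin n → A) →ₗ[A] (Fin n → A) := ι ∘ₗ C.totalD ∘ₗ π
  obtain ⟨v, hvz, hvF⟩ := p.exists_dotProduct_notMem (ι (Pi.single j z)) F (by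
    intro t ht w hw
    refine hzt (t₀ * t) (p.primeCompl.mul_mem ht₀ ht) ?_
    have h1 : (t • ι (Pi.single j z) - F w) ∈ p • (⊤ : Submodule A (Fin n → A)) := by
      rw [pi_eq_sum_univ (t • ι (Pi.single j z) - F w)]
      exact Submodule.sum_mem _ fun i _ => Submodule.smul_mem_smul (hw i) trivial
    have h2 := Submodule.mem_map_of_mem
      (f := (C.cycles j).subtype ∘ₗ pr ∘ₗ LinearMap.proj j ∘ₗ π) h1
    rw [Submodule.map_smul''] at h2
    have h3 : ((C.cycles j).subtype ∘ₗ pr ∘ₗ LinearMap.proj j ∘ₗ π)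
        (t • ι (Pi.single j z) - F w) = (t₀ * t) • z - C.d j (t₀ • π w (j + 1)) := by
      change (pr (π (t • ι (Pi.single j z) - ι (C.totalD (π w))) j) : C.M j) = _
      rw [map_sub, map_smul, hπι, hπι, Pi.sub_apply, Pi.smul_apply, Pi.single_eq_same, map_sub,
        Submodule.coe_sub, hpr _ (Submodule.smul_mem _ _ hz),
        show C.totalD (π w) j = C.d j (π w (j + 1)) from rfl, hpr _ (d_mem_cycles _ _), mul_smul,
        map_smul]
    rw [h3] at h2
    rw [← sub_add_cancel ((t₀ * t) • z) (C.d j (t₀ • π w (j + 1)))]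
    refine Submodule.add_mem _ (Submodule.mem_sup_right ?_) (Submodule.mem_sup_left ⟨_, rfl⟩)
    refine Submodule.smul_mono le_rfl ?_ h2
    rintro _ ⟨y, -, rfl⟩
    exact (pr _).2)
  -- the homotopies
  have hhom : ∀ l, ∃ N : ℕ, ∃ t ∉ p, ∃ h : ∀ i, C.M i →ₗ[A] C.M (i + 1),
      ∀ i, C.IsHomotopyAt (t * x l ^ N) h i := by
    intro l
    obtain ⟨u, hu, h, H⟩ := C.exists_homotopy (p.primeCompl ⊔ Submonoid.powers (x l)) (s + 1)
      fun i _ => by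
        obtain ⟨t, ht, N, hN⟩ := hann (x l) (hx l) i
        exact ⟨_, Submonoid.mul_mem_sup ht ⟨N, rfl⟩, hN⟩
    obtain ⟨t, ht, _, ⟨N, rfl⟩, rfl⟩ := Submonoid.mem_sup.mp hu
    refine ⟨N, t, ht, h, fun i => ?_⟩
    by_cases hi : i < s + 1
    · exact H i hi
    · exact isHomotopyAt_of_subsingleton _ _ (hC i (by omega))
  choose N t ht h H using hhom
  let M := ∑ l ∈ Finset.range (s + 1), N l
  have hM : ∀ l < s + 1, N l ≤ M := fun l hl =>
    Finset.single_le_sum (f := N) (fun _ _ => Nat.zero_le _) (Finset.mem_range.mpr hl)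
  let G : ℕ → (Fin n → A) →ₗ[A] (Fin n → A) := fun l =>
    x l ^ (M - N l) • (ι ∘ₗ totalH (h l) ∘ₗ π)
  have hG : ∀ l < s + 1, F ∘ₗ G l + G l ∘ₗ F = (t l * x l ^ M) • (ι ∘ₗ π) := by
    intro l hl
    refine LinearMap.ext fun w => ?_
    change ι (C.totalD (π (x l ^ (M - N l) • ι (totalH (h l) (π w))))) +
      x l ^ (M - N l) • ι (totalH (h l) (π (ι (C.totalD (π w))))) = (t l * x l ^ M) • ι (π w)
    rw [map_smul, map_smul, map_smul, hπι, hπι, ← smul_add, ← map_add, totalD_totalH_add (H l),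
      map_smul, ← mul_smul]
    congr 1
    rw [mul_left_comm, ← pow_add, Nat.sub_add_cancel (hM l hl)]
  let zp : ℕ → ∀ i, C.M i := Nat.rec (motive := fun _ => ∀ i, C.M i) (Pi.single j z)
    fun l y => x l ^ (M - N l) • totalH (h l) y
  have hzp : ∀ l, ∀ i < l, zp l i = 0 := by
    intro l
    induction l with
    | zero => simp
    | succ l ih =>
      intro i hi
      change x l ^ (M - N l) • totalH (h l) (zp l) i = 0
      rw [totalH_apply_eq_zero (h l) ih i hi, smul_zero]
  refine ⟨M, ChaseData.exists_of_linearMap p f hf F (ι ∘ₗ π) G x t M (fun l => ι (zp l)) v ?_ ?_ hG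
    ht ?_ ?_ ?_ ?_ hvz hvF⟩
  · refine LinearMap.ext fun w => ?_
    change ι (C.totalD (π (ι (C.totalD (π w))))) = 0
    rw [hπι, totalD_totalD, map_zero]
  · intro l _
    refine LinearMap.ext fun w => ?_
    change ι (π (x l ^ (M - N l) • ι (totalH (h l) (π w)))) = _
    rw [map_smul, hπι, map_smul]
    rfl
  · exact congrArg ι (hπι _)
  · change ι (C.totalD (π (ι (Pi.single j z)))) = 0
    rw [hπι, totalD_single hz, map_zero]
  · intro l
    change ι (x l ^ (M - N l) • totalH (h l) (zp l)) =
      x l ^ (M - N l) • ι (totalH (h l) (π (ι (zp l))))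
    rw [hπι, map_smul]
  · have : zp (s + 1) = 0 := by
      funext i
      by_cases hi : i < s + 1
      · exact hzp _ i hi
      · have := hC i (by omega)
        exact Subsingleton.elim _ _
    rw [this, map_zero]

end ModuleChain
end Total

section OfSupport

theorem exists_chaseData_of_minimal_support {A : Type*} [CommRing A] [IsNoetherianRing A]
    (s : ℕ) (E : ChainComplex (ModuleCat A) ℕ)
    (hproj : ∀ i, Module.Finite A (E.X i) ∧ Module.Projective A (E.X i))
    (hconc : ∀ i, s < i → IsZero (E.X i)) (p : Ideal A) (hp : p.IsPrime)
    (hmem : (⟨p, hp⟩ : PrimeSpectrum A) ∈ ⋃ i, Module.support A (E.homology i))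
    (hmin : ∀ (q : Ideal A) (hq : q.IsPrime),
      (⟨q, hq⟩ : PrimeSpectrum A) ∈ (⋃ i, Module.support A (E.homology i)) → q ≤ p → q = p)
    {D : Type*} [CommRing D] (f : A →+* D) (hf : ∀ t ∉ p, IsUnit (f t)) (x : ℕ → A)
    (hx : ∀ l, x l ∈ p) :
    ∃ M, ∃ S : ChaseData D (s + 1) (fun l => f (x l) ^ M), ∀ k, S.u k ∈ p.map f := by
  classical
  have hfin : ∀ i, Module.Finite A (E.X i) := fun i => (hproj i).1
  let C := ModuleChain.ofComplex E
  have : ∀ i, Module.Finite A (C.M i) := hfin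
  have : ∀ i, Module.Projective A (C.M i) := fun i => (hproj i).2
  have hC : ∀ i, s < i → Subsingleton (C.M i) := fun i hi =>
    ModuleCat.isZero_iff_subsingleton.mp (hconc i hi)
  have hex : ∃ j, Module.annihilator A (E.homology j) ≤ p := by
    obtain ⟨j, hj⟩ := Set.mem_iUnion.mp hmem
    exact ⟨j, (ModuleChain.mem_support_homology_iff E j _).mp hj⟩
  refine C.exists_chaseData hC p (j := Nat.find hex) (fun u hu => ?_) (fun i hi => ?_)
    (fun y hy i => ?_) f hf x hx
  · exact Nat.find_spec hex ((ModuleChain.mem_annihilator_homology_iff E _ u).mpr hu)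
  · obtain ⟨u, hu, hup⟩ := Set.not_subset.mp (Nat.find_min hex hi)
    exact ⟨u, hup, (ModuleChain.mem_annihilator_homology_iff E _ u).mp hu⟩
  · by_contra! hcon
    have hdis : Disjoint (Module.annihilator A (E.homology i) : Set A)
        (p.primeCompl ⊔ Submonoid.powers y : Submonoid A) := by
      rw [Set.disjoint_left]
      intro u hu hus
      obtain ⟨t, ht, _, ⟨N, rfl⟩, rfl⟩ := Submonoid.mem_sup.mp hus
      obtain ⟨z, hz, hw⟩ := hcon t ht N
      obtain ⟨w, hw'⟩ := (ModuleChain.mem_annihilator_homology_iff E i _).mp hu z hz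
      exact hw w hw'
    obtain ⟨q, hq, hle, hqd⟩ := Ideal.exists_le_prime_disjoint _ _ hdis
    have hqp : q ≤ p := fun a ha => by
      by_contra hap
      exact Set.disjoint_left.mp hqd ha (Submonoid.mem_sup_left (T := Submonoid.powers y) hap)
    have := hmin q hq (Set.mem_iUnion.mpr
      ⟨i, (ModuleChain.mem_support_homology_iff E i _).mpr hle⟩) hqp
    refine Set.disjoint_left.mp hqd (this ▸ hy : y ∈ q) ?_
    exact Submonoid.mem_sup_right (S := p.primeCompl) (Submonoid.mem_powers y)

end OfSupport

section CompleteLocal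

theorem MvPowerSeries.exists_algHom_of_isAdicComplete {σ k T : Type*} [Finite σ] [CommRing k]
    [CommRing T] [Algebra k T] (I : Ideal T) [IsAdicComplete I T] (x : σ → T)
    (hx : ∀ i, x i ∈ I) :
    ∃ φ : MvPowerSeries σ k →ₐ[k] T, ∀ i, φ (X i) = x i := by
  have hle : MvPolynomial.idealOfVars σ k ≤ I.comap (MvPolynomial.aeval (R := k) x) := by
    rw [MvPolynomial.idealOfVars, Ideal.span_le]
    rintro _ ⟨i, rfl⟩
    simpa using hx i
  have hpow (n : ℕ) : MvPolynomial.idealOfVars σ k ^ n ≤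
      (I ^ n).comap (MvPolynomial.aeval (R := k) x) :=
    (Ideal.pow_right_mono hle n).trans (Ideal.le_comap_pow _ n)
  let f (n : ℕ) : MvPowerSeries σ k →ₐ[k] T ⧸ I ^ n :=
    (Ideal.quotientMapₐ (I ^ n) (MvPolynomial.aeval (R := k) x) (hpow n)).comp
      ((truncTotalAlgHom σ k n).restrictScalars k)
  have hf (n : ℕ) (p : MvPowerSeries σ k) :
      f n p = Ideal.Quotient.mk _ (MvPolynomial.aeval x (truncTotal n p)) := rfl
  have hcomp {m n : ℕ} (h : m ≤ n) :
      (Ideal.Quotient.factorₐ k (Ideal.pow_le_pow_right h)).comp (f n) = f m := by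
    ext p
    rw [AlgHom.comp_apply, hf, hf]
    change Ideal.Quotient.mk (I ^ m) _ = _
    rw [Ideal.Quotient.eq, ← map_sub]
    exact hpow m (truncTotal_sub_truncTotal_mem_pow_idealOfVars h le_rfl p)
  refine ⟨IsAdicComplete.liftAlgHom I f hcomp, fun i => ?_⟩
  refine (IsHausdorff.eq_iff_smodEq (I := I)).mpr fun n => ?_
  rw [SModEq.sub_mem, smul_eq_mul, Ideal.mul_top, ← Ideal.Quotient.eq,
    IsAdicComplete.mk_liftAlgHom I f hcomp n, hf, Ideal.Quotient.eq,
    ← MvPolynomial.aeval_X (R := k) x i, ← map_sub]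
  refine hpow n ?_
  rw [MvPolynomial.mem_pow_idealOfVars_iff']
  intro m hm
  rw [MvPolynomial.coeff_sub, coeff_truncTotal _ hm, ← MvPolynomial.coe_X,
    MvPolynomial.coeff_coe, sub_self]

theorem IsPrecomplete.pi_fin {R : Type*} [CommRing R] (I : Ideal R) [IsPrecomplete I R] (n : ℕ) :
    IsPrecomplete I (Fin n → R) := by
  have hmem (m : ℕ) (v : Fin n → R) :
      v ∈ (I ^ m • ⊤ : Submodule R (Fin n → R)) ↔ ∀ i, v i ∈ (I ^ m • ⊤ : Submodule R R) := by
    constructor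
    · intro hv i
      have := Submodule.mem_map_of_mem (f := LinearMap.proj (R := R) (φ := fun _ => R) i) hv
      rw [Submodule.map_smul''] at this
      exact Submodule.smul_mono le_rfl le_top this
    · intro hv
      rw [← Finset.univ_sum_single v]
      refine Submodule.sum_mem _ fun i _ => ?_
      have := Submodule.mem_map_of_mem (f := LinearMap.single R (fun _ : Fin n => R) i) (hv i)
      rw [Submodule.map_smul''] at this
      exact Submodule.smul_mono le_rfl le_top this
  refine ⟨fun f hf => ?_⟩
  have key (i : Fin n) : ∃ L : R, ∀ m, f m i ≡ L [SMOD (I ^ m • ⊤ : Submodule R R)] := by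
    refine IsPrecomplete.prec' (fun m => f m i) fun h => ?_
    rw [SModEq.sub_mem]
    exact (hmem _ _).mp (SModEq.sub_mem.mp (hf h)) i
  choose L hL using key
  refine ⟨L, fun m => ?_⟩
  rw [SModEq.sub_mem, hmem]
  exact fun i => SModEq.sub_mem.mp (hL i m)

theorem Module.Finite.of_isPrecomplete {R M : Type*} [CommRing R] [AddCommGroup M] [Module R M]
    (I : Ideal R) [IsPrecomplete I R] [IsHausdorff I M] (F : Submodule R M) (hF : F.FG)
    (h : ∀ y, ∃ a ∈ F, y - a ∈ (I • ⊤ : Submodule R M)) : Module.Finite R M := by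
  obtain ⟨n, g, rfl⟩ := Submodule.fg_iff_exists_fin_generating_family.mp hF
  have := IsPrecomplete.pi_fin I n
  refine Module.Finite.of_surjective (Fintype.linearCombination R g)
    (surjective_of_mkQ_comp_surjective (I := I) fun y => ?_)
  obtain ⟨y, rfl⟩ := Submodule.Quotient.mk_surjective _ y
  obtain ⟨a, ha, hb⟩ := h y
  rw [← Fintype.range_linearCombination R g] at ha
  obtain ⟨c, rfl⟩ := ha
  refine ⟨c, ?_⟩
  rw [LinearMap.comp_apply, Submodule.mkQ_apply, Submodule.Quotient.eq, ← neg_mem_iff, neg_sub]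
  exact hb

/-- Modulo each power of a finitely generated ideal with residue ring covered by `R`, the algebra
`T` is a finitely generated `R`-module. -/
theorem Ideal.exists_fg_sup_pow_eq_top {R T : Type*} [CommRing R] [CommRing T] [Algebra R T]
    (m : Ideal T) (hm : m.FG) (hres : ∀ t : T, ∃ r : R, t - algebraMap R T r ∈ m) (n : ℕ) :
    ∃ F : Submodule R T, F.FG ∧ ∀ t : T, ∃ a ∈ F, t - a ∈ m ^ n := by
  induction n with
  | zero => exact ⟨⊥, Submodule.fg_bot, fun t => ⟨0, by simp, by simp⟩⟩
  | succ n ih =>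
    obtain ⟨F, hF, h⟩ := ih
    obtain ⟨Y, hY⟩ := hm
    refine ⟨Submodule.span R {1} ⊔ Submodule.span R Y * F,
      (Submodule.fg_span_singleton 1).sup ((Submodule.fg_span Y.finite_toSet).mul hF), fun t => ?_⟩
    have key (z : T) (hz : z ∈ m) (c : T) :
        ∃ a ∈ Submodule.span R (Y : Set T) * F, c * z - a ∈ m ^ (n + 1) := by
      rw [← hY] at hz
      induction hz using Submodule.span_induction generalizing c with
      | mem z hz =>
        obtain ⟨a, ha, h'⟩ := h c
        refine ⟨z * a, Submodule.mul_mem_mul (Submodule.subset_span hz) ha, ?_⟩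
        rw [pow_succ']
        have := Ideal.mul_mem_mul (hY ▸ Submodule.subset_span hz : z ∈ m) h'
        rwa [mul_sub, mul_comm z c] at this
      | zero => exact ⟨0, zero_mem _, by simp⟩
      | add z w _ _ hz hw =>
        obtain ⟨a, ha, h1⟩ := hz c
        obtain ⟨b, hb, h2⟩ := hw c
        exact ⟨a + b, add_mem ha hb, by rw [mul_add, add_sub_add_comm]; exact add_mem h1 h2⟩
      | smul b z _ ih => simpa [mul_assoc] using ih (c * b)
    obtain ⟨r, hr⟩ := hres t
    obtain ⟨a, ha, h'⟩ := key _ hr 1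
    rw [one_mul] at h'
    refine ⟨algebraMap R T r + a, Submodule.add_mem_sup ?_ ha, by rwa [← sub_sub]⟩
    rw [Algebra.algebraMap_eq_smul_one]
    exact Submodule.smul_mem _ _ (Submodule.mem_span_singleton_self 1)

end CompleteLocal

section CompleteLocal

open MvPowerSeries in
/-- A ring which is complete for an ideal `m` is finite over a power series ring whose variables
generate an ideal containing a power of `m`. -/
theorem MvPowerSeries.finite_of_isAdicComplete {d : ℕ} {k T : Type*} [Field k] [CommRing T]
    [Algebra (MvPowerSeries (Fin d) k) T] (m : Ideal T) [IsAdicComplete m T] (hm : m.FG)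
    (hres : ∀ t : T, ∃ r : MvPowerSeries (Fin d) k, t - algebraMap _ T r ∈ m)
    (hle : (Ideal.span (Set.range X)).map (algebraMap (MvPowerSeries (Fin d) k) T) ≤ m)
    (N : ℕ) (hN : m ^ N ≤ (Ideal.span (Set.range X)).map (algebraMap (MvPowerSeries (Fin d) k) T)) :
    Module.Finite (MvPowerSeries (Fin d) k) T := by
  have hsmul (J : Ideal (MvPowerSeries (Fin d) k)) (t : T) :
      t ∈ (J • ⊤ : Submodule (MvPowerSeries (Fin d) k) T) ↔ t ∈ J.map (algebraMap _ T) := by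
    rw [Ideal.smul_top_eq_map, Submodule.restrictScalars_mem]
  obtain ⟨F, hF, h⟩ := m.exists_fg_sup_pow_eq_top hm hres N
  have : IsHausdorff (Ideal.span (Set.range X) : Ideal (MvPowerSeries (Fin d) k)) T := by
    refine ⟨fun t ht => IsHausdorff.haus' (I := m) t fun n => ?_⟩
    have := ht n
    rw [SModEq.zero, hsmul, Ideal.map_pow] at this
    rw [SModEq.zero, smul_eq_mul, Ideal.mul_top]
    exact Ideal.pow_right_mono hle n this
  refine Module.Finite.of_isPrecomplete (Ideal.span (Set.range X)) F hF fun t => ?_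
  obtain ⟨a, ha, hta⟩ := h t
  exact ⟨a, ha, (hsmul _ _).mpr (hN hta)⟩

namespace MvPowerSeries

/-- A power series not vanishing on the first axis is, up to a unit, a power of the first variable
modulo the other variables. -/
theorem exists_X_pow_mul_sub_mem_span {d : ℕ} {k : Type*} [Field k]
    (g : MvPowerSeries (Fin (d + 1)) k) (hg : restrictAxis d k g ≠ 0) :
    ∃ (r : ℕ) (w : MvPowerSeries (Fin (d + 1)) k), IsUnit w ∧
      g - X 0 ^ r * w ∈ Ideal.span (Set.range fun i : Fin d => (X i.succ :
        MvPowerSeries (Fin (d + 1)) k)) := by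
  classical
  have hex : ∃ r, coeff (Finsupp.cons r 0) g ≠ 0 := by
    by_contra! h
    exact hg (PowerSeries.ext fun r => by rw [coeff_restrictAxis, h r, map_zero])
  let r := Nat.find hex
  let w : MvPowerSeries (Fin (d + 1)) k := fun m => coeff (Finsupp.single 0 r + m) g
  have hw (m) : coeff m w = coeff (Finsupp.single 0 r + m) g := rfl
  have hcons (j : ℕ) : (Finsupp.cons j 0 : Fin (d + 1) →₀ ℕ) = Finsupp.single 0 j := by
    ext i
    refine Fin.cases ?_ (fun i => ?_) i
    · simp
    · simp
  refine ⟨r, w, ?_, ?_⟩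
  · rw [isUnit_iff_constantCoeff, isUnit_iff_ne_zero, ← coeff_zero_eq_constantCoeff_apply, hw,
      add_zero, ← hcons]
    exact Nat.find_spec hex
  · have hset : (Set.range fun i : Fin d => (X i.succ : MvPowerSeries (Fin (d + 1)) k)) =
        (fun i => X i ^ 1) '' ((Finset.univ.erase 0 : Finset (Fin (d + 1))) : Set (Fin (d + 1))) := by
      ext y
      constructor
      · rintro ⟨i, rfl⟩
        exact ⟨i.succ, by simp, by simp⟩
      · rintro ⟨i, hi, rfl⟩
        obtain ⟨j, rfl⟩ := Fin.exists_succ_eq.mpr (by simpa using hi)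
        exact ⟨j, by simp⟩
    rw [hset, mem_span_X_pow_iff]
    intro m hm
    have hm' : m = Finsupp.single 0 (m 0) := by
      ext i
      refine Fin.cases (by simp) (fun i => ?_) i
      rw [Finsupp.single_apply, if_neg (Fin.succ_ne_zero i).symm]
      exact Nat.lt_one_iff.mp (hm i.succ (by simp))
    rw [map_sub, X_pow_eq, coeff_monomial_mul]
    split_ifs with h
    · rw [hw, one_mul, add_tsub_cancel_of_le h, sub_self]
    · rw [sub_zero, hm', ← hcons]
      refine not_not.mp (Nat.find_min hex (m := m 0) ?_)
      by_contra hlt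
      refine h ?_
      rw [hm']
      exact Finsupp.single_le_single.mpr (not_lt.mp hlt)

end MvPowerSeries

open IsLocalRing

/-- Ideals of a Noetherian local ring are contracted from any algebra mapping compatibly to all the
quotients by powers of the maximal ideal. -/
theorem IsLocalRing.mem_of_algebraMap_mem_map {S T : Type*} [CommRing S] [IsLocalRing S]
    [IsNoetherianRing S] [CommRing T] [Algebra S T]
    (ev : ∀ n, T →ₐ[S] S ⧸ maximalIdeal S ^ n) (J : Ideal S) (z : S)
    (hz : algebraMap S T z ∈ J.map (algebraMap S T)) : z ∈ J := by
  rw [← Ideal.Quotient.eq_zero_iff_mem]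
  refine IsHausdorff.haus' (I := maximalIdeal S) (Ideal.Quotient.mk J z) fun n => ?_
  rw [SModEq.zero]
  have h := Ideal.mem_map_of_mem (ev n : T →+* S ⧸ maximalIdeal S ^ n) hz
  rw [Ideal.map_map, AlgHom.comp_algebraMap] at h
  erw [AlgHom.commutes] at h
  rw [Ideal.Quotient.algebraMap_eq] at h
  obtain ⟨b, hb, hbz⟩ := (Ideal.mem_map_iff_of_surjective _ Ideal.Quotient.mk_surjective).mp h
  rw [Ideal.Quotient.eq, ← neg_mem_iff, neg_sub] at hbz
  have hz' : Ideal.Quotient.mk J z = (z - b) • (1 : S ⧸ J) := by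
    rw [Algebra.smul_def, mul_one, Ideal.Quotient.algebraMap_eq, Ideal.Quotient.eq]
    simpa using hb
  rw [hz']
  exact Submodule.smul_mem_smul hbz Submodule.mem_top

open MvPowerSeries in
/-- A system of parameters of a Noetherian local ring is analytically independent. -/
theorem MvPowerSeries.injective_of_systemOfParameters {S T k : Type*} [CommRing S] [IsLocalRing S]
    [IsNoetherianRing S] [CommRing T] [Algebra S T] [Field k]
    (ev : ∀ n, T →ₐ[S] S ⧸ maximalIdeal S ^ n) {d : ℕ} (hd : (d : ℕ∞) ≤ (maximalIdeal S).height)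
    (x : Fin d → S) (hx : ∀ i, x i ∈ maximalIdeal S)
    (hrad : maximalIdeal S ≤ (Ideal.span (Set.range x)).radical)
    (φ : MvPowerSeries (Fin d) k →+* T) (hφ : ∀ i, φ (X i) = algebraMap S T (x i)) :
    Function.Injective φ := by
  rw [injective_iff_map_eq_zero]
  intro f hf
  by_contra hf0
  cases d with
  | zero =>
    have : Nontrivial (S ⧸ maximalIdeal S ^ 1) := by
      rw [pow_one]
      exact Ideal.Quotient.nontrivial_iff.mpr Ideal.IsPrime.ne_top'
    have : Nontrivial T := (ev 1).toRingHom.domain_nontrivial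
    have hu : IsUnit f := by
      rw [isUnit_iff_constantCoeff, isUnit_iff_ne_zero]
      intro h
      refine hf0 (ext fun m => ?_)
      rw [Subsingleton.elim m 0, coeff_zero_eq_constantCoeff_apply, h, map_zero]
    exact (hu.map φ).ne_zero hf
  | succ d =>
    obtain ⟨n, hn, hg⟩ := exists_restrictAxis_substAlgHom_ne_zero f hf0
    obtain ⟨r, w, hw, hspan⟩ := exists_X_pow_mul_sub_mem_span _ hg
    let ψ : MvPowerSeries (Fin (d + 1)) k →+* T :=
      φ.comp (substAlgHom (R := k) (hasSubst_shearPoint (-1) hn)).toRingHom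
    have hψ (i) : ψ (X i) = φ (shearPoint (-1) n i) := by
      change φ (substAlgHom (R := k) (hasSubst_shearPoint (-1) hn) (X i)) = _
      rw [substAlgHom_X]
    have hψ0 : ψ (X 0) = algebraMap S T (x 0) := by rw [hψ, ← hφ]; rfl
    have hψs (i : Fin d) : ψ (X i.succ) = algebraMap S T (x i.succ - x 0 ^ n i) := by
      rw [hψ, map_sub, map_pow, ← hφ, ← hφ]
      simp [shearPoint, sub_eq_add_neg]
    have hψg : ψ (substAlgHom (R := k) (hasSubst_shearPoint 1 hn) f) = 0 := by
      change φ (substAlgHom (R := k) (hasSubst_shearPoint (-1) hn) _) = 0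
      rw [substAlgHom_shearPoint_comp 1 hn f, hf]
    let J : Ideal S := Ideal.span (Set.range fun i : Fin d => x i.succ - x 0 ^ n i)
    have hJ (i : Fin d) : x i.succ - x 0 ^ n i ∈ J := Ideal.subset_span ⟨i, rfl⟩
    have h0 : x 0 ^ r ∈ J := by
      refine mem_of_algebraMap_mem_map ev J _ ?_
      have h1 := Ideal.mem_map_of_mem ψ hspan
      have h2 : (Ideal.span (Set.range fun i : Fin d => (X i.succ :
          MvPowerSeries (Fin (d + 1)) k))).map ψ = J.map (algebraMap S T) := by
        rw [Ideal.map_span, Ideal.map_span, ← Set.range_comp, ← Set.range_comp]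
        congr 2
        funext i
        exact hψs i
      rw [h2, map_sub, hψg, zero_sub, neg_mem_iff, map_mul, map_pow, hψ0, ← map_pow] at h1
      exact (Ideal.mul_unit_mem_iff_mem _ (hw.map ψ)).mp h1
    have hrad0 : x 0 ∈ J.radical := ⟨r, h0⟩
    have hmJ : maximalIdeal S ≤ J.radical := by
      refine hrad.trans ((Ideal.radical_mono (Ideal.span_le.mpr ?_)).trans_eq
        (Ideal.radical_idem J))
      rintro _ ⟨i, rfl⟩
      refine Fin.cases hrad0 (fun i => ?_) i
      have := add_mem (Ideal.le_radical (hJ i)) (Ideal.pow_mem_of_mem _ hrad0 _ (hn i))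
      simpa using this
    have hmin : maximalIdeal S ∈ J.minimalPrimes := by
      refine ⟨⟨inferInstance, Ideal.span_le.mpr ?_⟩, fun q hq _ => ?_⟩
      · rintro _ ⟨i, rfl⟩
        exact sub_mem (hx _) (Ideal.pow_mem_of_mem _ (hx _) _ (hn i))
      · exact hmJ.trans (hq.1.radical_le_iff.mpr hq.2)
    have h1 := Ideal.height_le_card_of_mem_minimalPrimes_span (Set.finite_range _) hmin
    have h2 : (Set.range fun i : Fin d => x i.succ - x 0 ^ n i).ncard ≤ d := by
      rw [← Set.image_univ]
      exact (Set.ncard_image_le).trans_eq (by simp [Set.ncard_univ])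
    have h3 : ((d + 1 : ℕ) : ℕ∞) ≤ d := hd.trans (h1.trans (by exact_mod_cast h2))
    have : d + 1 ≤ d := by exact_mod_cast h3
    omega

end CompleteLocal

section CompleteLocal

/-- A finite algebra over a domain which has no zero divisors and contains the base is, up to
multiplication by a nonzero scalar, a free module. -/
theorem Module.Finite.exists_factor_smul_through_pi {R D : Type*} [CommRing R] [IsDomain R]
    [CommRing D] [IsDomain D] [Algebra R D] [Module.Finite R D]
    (hinj : Function.Injective (algebraMap R D)) :
    ∃ (N : ℕ) (α : D →ₗ[R] Fin N → R) (β : (Fin N → R) →ₗ[R] D) (c : R) (i₀ : Fin N),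
      (∀ w, β (α w) = c • w) ∧ c * α 1 i₀ ≠ 0 := by
  classical
  obtain ⟨n, v, hv⟩ := Module.Finite.exists_fin (R := R) (M := D)
  obtain ⟨s, hs, hmax⟩ := exists_maximal_linearIndepOn R v
  have hex (i : Fin n) : ∃ a : R, a ≠ 0 ∧ a • v i ∈ Submodule.span R (v '' s) := by
    by_cases hi : i ∈ s
    · exact ⟨1, one_ne_zero, by rw [one_smul]; exact Submodule.subset_span ⟨i, hi, rfl⟩⟩
    · exact hmax i hi
  choose a ha hmem using hex
  let c := ∏ i, a i
  have hc : c ≠ 0 := Finset.prod_ne_zero_iff.mpr fun i _ => ha i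
  have hcD (w : D) : c • w ∈ Submodule.span R (v '' s) := by
    have hw : w ∈ Submodule.span R (Set.range v) := hv ▸ Submodule.mem_top
    induction hw using Submodule.span_induction with
    | mem w hw =>
      obtain ⟨i, rfl⟩ := hw
      have : c = (∏ j ∈ Finset.univ.erase i, a j) * a i :=
        (Finset.prod_erase_mul _ _ (Finset.mem_univ i)).symm
      rw [this, mul_smul]
      exact Submodule.smul_mem _ _ (hmem i)
    | zero => simp
    | add x y _ _ hx hy => rw [smul_add]; exact add_mem hx hy
    | smul r x _ hx => rw [smul_comm]; exact Submodule.smul_mem _ _ hx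
  let b := Module.Basis.span hs
  let e := Fintype.equivFin s
  have hrange : Set.range (fun i : s => v i) = v '' s := (Set.image_eq_range v s).symm
  have hcD' (w : D) : c • w ∈ Submodule.span R (Set.range fun i : s => v i) := hrange ▸ hcD w
  let α₀ : D →ₗ[R] Submodule.span R (Set.range fun i : s => v i) :=
    LinearMap.codRestrict _ (c • LinearMap.id) hcD'
  let b' := b.reindex e
  let α : D →ₗ[R] Fin (Fintype.card s) → R := b'.equivFun.toLinearMap ∘ₗ α₀
  let β : (Fin (Fintype.card s) → R) →ₗ[R] D :=
    (Submodule.subtype _) ∘ₗ b'.equivFun.symm.toLinearMap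
  have hβ (w : D) : β (α w) = c • w := by
    simp only [α, β, LinearMap.comp_apply, LinearEquiv.coe_coe, LinearEquiv.symm_apply_apply]
    rfl
  have hα : α 1 ≠ 0 := by
    intro h
    have h1 := hβ 1
    rw [h, map_zero, ← Algebra.algebraMap_eq_smul_one] at h1
    exact hc ((map_eq_zero_iff _ hinj).mp h1.symm)
  obtain ⟨i₀, hi₀⟩ := Function.ne_iff.mp hα
  exact ⟨_, α, β, c, i₀, hβ, mul_ne_zero hc hi₀⟩

theorem Algebra.FormallySmooth.of_charZero (k L : Type*) [Field k] [CharZero k] [Field L]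
    [Algebra k L] : Algebra.FormallySmooth k L := by
  obtain ⟨s, hs⟩ := exists_isTranscendenceBasis k L
  have := hs.isAlgebraic_field
  exact .of_algebraicIndependent_of_isSeparable hs.1

open IsLocalRing in
/-- **Cohen's structure theorem** in equal characteristic zero: existence of a coefficient field. -/
theorem IsLocalRing.exists_residueField_section (k T : Type*) [Field k] [CharZero k] [CommRing T]
    [IsLocalRing T] [IsAdicComplete (maximalIdeal T) T] [Algebra k T] :
    ∃ g : ResidueField T →+* T, ∀ z, residue T (g z) = z := by
  have := Algebra.FormallySmooth.of_charZero k (ResidueField T)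
  obtain ⟨g, hg⟩ := Algebra.FormallySmooth.exists_mkₐ_comp_eq_of_isAdicComplete
    (R := k) (I := maximalIdeal T) (AlgHom.id k (ResidueField T))
  exact ⟨g, fun z => DFunLike.congr_fun hg z⟩

end CompleteLocal

section CompleteLocal

open IsLocalRing MvPowerSeries in
/-- A Noetherian local ring of equal characteristic zero maps to a domain which is finite over a
power series ring, such that a given system of parameters maps to the variables. -/
theorem IsLocalRing.exists_finite_domain_over_mvPowerSeries (k S : Type) [Field k] [CharZero k]
    [CommRing S] [IsLocalRing S] [IsNoetherianRing S] [Algebra k S] {d : ℕ}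
    (hd : (d : ℕ∞) ≤ (maximalIdeal S).height) (x : Fin d → S) (hx : ∀ i, x i ∈ maximalIdeal S)
    (hrad : maximalIdeal S ≤ (Ideal.span (Set.range x)).radical) :
    ∃ (K : Type) (_ : Field K) (_ : CharZero K) (D : Type) (_ : CommRing D) (_ : IsDomain D)
      (_ : Algebra (MvPowerSeries (Fin d) K) D) (_ : Module.Finite (MvPowerSeries (Fin d) K) D)
      (f : S →+* D) (a : ℕ), Function.Injective (algebraMap (MvPowerSeries (Fin d) K) D) ∧
      (∀ i, f (x i) = algebraMap (MvPowerSeries (Fin d) K) D (X i)) ∧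
      ∀ u ∈ (maximalIdeal S).map f, u ^ a ∈ (Ideal.span (Set.range X)).map
        (algebraMap (MvPowerSeries (Fin d) K) D) := by
  let T := AdicCompletion (maximalIdeal S) S
  obtain ⟨g, hg⟩ := IsLocalRing.exists_residueField_section k T
  let K := ResidueField T
  let _ : Algebra K T := g.toAlgebra
  have hK : CharZero K := charZero_of_injective_algebraMap (algebraMap k K).injective
  have hmT : maximalIdeal T = (maximalIdeal S).map (algebraMap S T) :=
    AdicCompletion.maximalIdeal_eq_map
  obtain ⟨φ, hφ⟩ := MvPowerSeries.exists_algHom_of_isAdicComplete (k := K) (maximalIdeal T)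
    (fun i => algebraMap S T (x i)) fun i => hmT ▸ Ideal.mem_map_of_mem _ (hx i)
  have hφinj : Function.Injective φ := MvPowerSeries.injective_of_systemOfParameters
    (fun n => AdicCompletion.evalₐ (maximalIdeal S) n) hd x hx hrad φ.toRingHom hφ
  obtain ⟨N, hN⟩ := Ideal.exists_pow_le_of_le_radical_of_fg hrad
    (maximalIdeal S).fg_of_isNoetherianRing
  let _ : Algebra (MvPowerSeries (Fin d) K) T := φ.toRingHom.toAlgebra
  have hspan : (Ideal.span (Set.range X)).map (algebraMap (MvPowerSeries (Fin d) K) T) =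
      (Ideal.span (Set.range x)).map (algebraMap S T) := by
    rw [Ideal.map_span, Ideal.map_span, ← Set.range_comp, ← Set.range_comp]
    congr 2
    funext i
    exact hφ i
  have hfin : Module.Finite (MvPowerSeries (Fin d) K) T := by
    refine MvPowerSeries.finite_of_isAdicComplete (maximalIdeal T) ?_ (fun t => ?_) ?_ N ?_
    · rw [hmT]
      exact (maximalIdeal S).fg_of_isNoetherianRing.map _
    · refine ⟨C (residue T t), ?_⟩
      have : algebraMap (MvPowerSeries (Fin d) K) T (C (residue T t)) = g (residue T t) :=
        φ.commutes (residue T t)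
      rw [this, ← residue_eq_zero_iff, map_sub, hg, sub_self]
    · rw [hspan, hmT]
      refine Ideal.map_mono (Ideal.span_le.mpr ?_)
      rintro _ ⟨i, rfl⟩
      exact hx i
    · rw [hspan, hmT, ← Ideal.map_pow]
      exact Ideal.map_mono hN
  obtain ⟨Q, -, hQ, hQR⟩ := Ideal.exists_ideal_over_prime_of_isIntegral
    (⊥ : Ideal (MvPowerSeries (Fin d) K)) (⊥ : Ideal T)
    (by
      rw [← RingHom.ker_eq_comap_bot]
      exact ((RingHom.injective_iff_ker_eq_bot (algebraMap (MvPowerSeries (Fin d) K) T)).mp hφinj).le)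
  refine ⟨K, inferInstance, hK, T ⧸ Q, inferInstance, inferInstance, inferInstance, inferInstance,
    (Ideal.Quotient.mk Q).comp (algebraMap S T), N, ?_, fun i => ?_, fun u hu => ?_⟩
  · rw [injective_iff_map_eq_zero]
    intro r hr
    have : r ∈ Q.comap (algebraMap _ T) :=
      Ideal.mem_comap.mpr (Ideal.Quotient.eq_zero_iff_mem.mp hr)
    rwa [hQR] at this
  · rw [RingHom.comp_apply, ← hφ]
    rfl
  · have h1 : u ^ N ∈ ((maximalIdeal S).map ((Ideal.Quotient.mk Q).comp (algebraMap S T))) ^ N :=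
      Ideal.pow_mem_pow hu N
    have h2 : (Ideal.span (Set.range X)).map (algebraMap (MvPowerSeries (Fin d) K) (T ⧸ Q)) =
        ((Ideal.span (Set.range X)).map (algebraMap (MvPowerSeries (Fin d) K) T)).map
          (Ideal.Quotient.mk Q) := by
      rw [Ideal.map_map]
      rfl
    rw [← Ideal.map_pow] at h1
    rw [h2, hspan, Ideal.map_map]
    exact Ideal.map_mono hN h1

end CompleteLocal

section CompleteLocal

open MvPowerSeries in
/-- The local ring of a prime of height `d`, in equal characteristic zero, maps to a domain finite
over a power series ring in `d` variables, the variables being images of elements of the prime. -/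
theorem Ideal.exists_finite_domain_over_mvPowerSeries (k A : Type) [Field k] [CharZero k]
    [CommRing A] [IsNoetherianRing A] [Algebra k A] (p : Ideal A) [p.IsPrime] {d : ℕ}
    (hd : (d : ℕ∞) = p.height) :
    ∃ (x : Fin d → A) (K : Type) (_ : Field K) (_ : CharZero K) (D : Type) (_ : CommRing D)
      (_ : IsDomain D) (_ : Algebra (MvPowerSeries (Fin d) K) D)
      (_ : Module.Finite (MvPowerSeries (Fin d) K) D) (f : A →+* D) (a : ℕ),
      (∀ i, x i ∈ p) ∧ (∀ t ∉ p, IsUnit (f t)) ∧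
      Function.Injective (algebraMap (MvPowerSeries (Fin d) K) D) ∧
      (∀ i, f (x i) = algebraMap (MvPowerSeries (Fin d) K) D (X i)) ∧
      ∀ u ∈ p.map f, u ^ a ∈ (Ideal.span (Set.range X)).map
        (algebraMap (MvPowerSeries (Fin d) K) D) := by
  obtain ⟨F, hF, hcard⟩ := p.exists_finset_card_eq_height_of_isNoetherianRing
  obtain rfl : F.card = d := by exact_mod_cast hcard.trans hd.symm
  let x : Fin F.card → A := fun i => F.equivFin.symm i
  have hxp (i) : x i ∈ p := hF.1.2 (Ideal.subset_span (F.equivFin.symm i).2)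
  have hrange : Set.range x = F := by
    ext y
    exact ⟨by rintro ⟨i, rfl⟩; exact (F.equivFin.symm i).2,
      fun hy => ⟨F.equivFin ⟨y, hy⟩, by simp [x]⟩⟩
  have hmax : p.map (algebraMap A (Localization.AtPrime p)) =
      IsLocalRing.maximalIdeal (Localization.AtPrime p) :=
    Localization.AtPrime.map_eq_maximalIdeal
  have hheight : (IsLocalRing.maximalIdeal (Localization.AtPrime p)).height = p.height :=
    WithBot.coe_injective ((IsLocalRing.maximalIdeal_height_eq_ringKrullDim).trans
      (IsLocalization.AtPrime.ringKrullDim_eq_height p (Localization.AtPrime p)))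
  have hrad : IsLocalRing.maximalIdeal (Localization.AtPrime p) ≤
      (Ideal.span (Set.range (algebraMap A (Localization.AtPrime p) ∘ x))).radical := by
    have h := IsLocalization.AtPrime.radical_map_of_mem_minimalPrimes
      (A := Localization.AtPrime p) p _ hF
    rw [← hrange, Ideal.map_span, ← Set.range_comp] at h
    exact (h.trans hmax).ge
  obtain ⟨K, _, _, D, _, _, _, _, f, a, hinj, hfx, hfu⟩ :=
    IsLocalRing.exists_finite_domain_over_mvPowerSeries k (Localization.AtPrime p) (d := F.card)
      (hd.trans hheight.symm).le (algebraMap A (Localization.AtPrime p) ∘ x)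
      (fun i => hmax ▸ Ideal.mem_map_of_mem _ (hxp i)) hrad
  refine ⟨x, K, inferInstance, inferInstance, D, inferInstance, inferInstance, inferInstance,
    inferInstance, f.comp (algebraMap A (Localization.AtPrime p)), a, hxp, fun t ht => ?_, hinj,
    hfx, fun u hu => hfu u ?_⟩
  · exact (IsLocalization.map_units (Localization.AtPrime p) (⟨t, ht⟩ : p.primeCompl)).map f
  · rwa [← hmax, Ideal.map_map]

end CompleteLocal

theorem Ideal.height_le_of_minimal_mem_support
    (A : Type) [CommRing A] [IsNoetherianRing A] [Algebra ℂ A]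
    (s : ℕ) (E : ChainComplex (ModuleCat A) ℕ)
    (hproj : ∀ i, Module.Finite A (E.X i) ∧ Module.Projective A (E.X i))
    (hconc : ∀ i, s < i → IsZero (E.X i))
    (p : Ideal A) (hp : p.IsPrime)
    (hmem : (⟨p, hp⟩ : PrimeSpectrum A) ∈ ⋃ i, Module.support A (E.homology i))
    (hmin : ∀ (q : Ideal A) (hq : q.IsPrime),
      (⟨q, hq⟩ : PrimeSpectrum A) ∈ (⋃ i, Module.support A (E.homology i)) → q ≤ p → q = p) :
    p.height ≤ s := by
  obtain ⟨d, hd⟩ := ENat.ne_top_iff_exists.mp (Ideal.height_ne_top hp.ne_top)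
  rw [← hd, Nat.cast_le]
  by_contra! hsd
  obtain ⟨x, K, _, _, D, _, _, _, _, f, a, hxp, hunit, hinj, hfx, hfu⟩ :=
    p.exists_finite_domain_over_mvPowerSeries ℂ A hd
  obtain ⟨N, α, β, c, i₀, hβ, hne⟩ := Module.Finite.exists_factor_smul_through_pi hinj
  obtain ⟨y, hyp, hy⟩ : ∃ y : ℕ → A, (∀ l, y l ∈ p) ∧ ∀ l (hl : l < d), y l = x ⟨l, hl⟩ :=
    ⟨fun l => if h : l < d then x ⟨l, h⟩ else 0, fun l => by
      dsimp only
      split_ifs with h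
      exacts [hxp _, zero_mem p], fun l hl => dif_pos hl⟩
  obtain ⟨M, C, hC⟩ := exists_chaseData_of_minimal_support s E hproj hconc p hp hmem hmin
    f hunit y hyp
  refine ChaseData.false_of_charZero (M := M) (a := a) hsd α β c hβ i₀ hne C (fun l hl => ?_)
    fun j => hfu _ (hC j)
  rw [hy l (hl.trans_le hsd), map_pow, ← hfx]

/-- If `E` is a non-exact complex of finitely generated projective modules over a
Noetherian `ℂ`-algebra `A`, concentrated in degrees `0,…,s`, and `p` is a prime ideal
minimal in the support `⋃ i, Supp (H_i E)` of the homology of `E`, then the height of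
`p` (the Krull dimension of `A_p`) is at most `s`. -/
theorem height_of_minimal_support_prime_le
    (A : Type) [CommRing A] [IsNoetherianRing A] [Algebra ℂ A]
    (s : ℕ) (E : ChainComplex (ModuleCat A) ℕ)
    (hproj : ∀ i, Module.Finite A (E.X i) ∧ Module.Projective A (E.X i))
    (hconc : ∀ i, s < i → IsZero (E.X i))
    (hnonexact : ∃ i, ¬ IsZero (E.homology i))
    (p : Ideal A) (hp : p.IsPrime)
    (hmem : (⟨p, hp⟩ : PrimeSpectrum A) ∈ ⋃ i, Module.support A (E.homology i))
    (hmin : ∀ (q : Ideal A) (hq : q.IsPrime),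
      (⟨q, hq⟩ : PrimeSpectrum A) ∈ (⋃ i, Module.support A (E.homology i)) →
      q ≤ p → q = p) :
    ringKrullDim (Localization.AtPrime p) ≤ (s : WithBot (WithTop ℕ)) := by
  rw [IsLocalization.AtPrime.ringKrullDim_eq_height p (Localization.AtPrime p)]
  exact WithBot.coe_le_coe.mpr
    (Ideal.height_le_of_minimal_mem_support A s E hproj hconc p hp hmem hmin)
end
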